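/- For every n ≥ 512 and all points p_1,…,p_n in general position in P^3, the radical ideal I = ∩_{j=1}^n m_{p_j} ⊆ k[P^3] satisfies I^(3r) ⊆ M^{2r}·I^r for all integers r ≥ 1. -/

import Mathlib

open MvPolynomial Filter

/-- The homogeneous ideal of all forms vanishing at the (projective) point with
coordinate vector `p`. -/
noncomputable def pointIdeal {k : Type*} [Field k] {σ : Type*} (p : σ → k) :
    Ideal (MvPolynomial σ k) :=
  Ideal.span { f | (∃ d, f.IsHomogeneous d) ∧ eval p f = 0 }

/-- The fat points ideal `⋂ⱼ m_{pⱼ}^{mⱼ}` (natural multiplicities). -/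
noncomputable def fatIdeal {k : Type*} [Field k] {N n : ℕ} (p : Fin n → (Fin (N + 1) → k))
    (m : Fin n → ℕ) : Ideal (MvPolynomial (Fin (N + 1)) k) :=
  ⨅ j, pointIdeal (p j) ^ (m j)

/-- The fat points ideal with integer multiplicities, with the convention
`m_p^m = (1)` for `m ≤ 0`. -/
noncomputable def fatIdealZ {k : Type*} [Field k] {N n : ℕ} (p : Fin n → (Fin (N + 1) → k))
    (m : Fin n → ℤ) : Ideal (MvPolynomial (Fin (N + 1)) k) :=
  ⨅ j, pointIdeal (p j) ^ (m j).toNat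

/-- The irrelevant maximal ideal `M = (x_0, …, x_N)`. -/
noncomputable def maxIdeal (k : Type*) [Field k] (N : ℕ) : Ideal (MvPolynomial (Fin (N + 1)) k) :=
  Ideal.span (Set.range X)

/-- `α(I)`: the least `t ≥ 0` such that `I` contains a nonzero form of degree `t`. -/
noncomputable def alpha {k : Type*} [Field k] {σ : Type*}
    (I : Ideal (MvPolynomial σ k)) : ℕ :=
  sInf { t | ∃ f ∈ I, f ≠ 0 ∧ f.IsHomogeneous t }

/-- The sequence `t ↦ α(I^{(t)})/t` attached to the fat points ideal with points `p`
and multiplicities `m`; its limit as `t → ∞` is the Waldschmidt constant `γ`. -/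
noncomputable def alphaSeq {k : Type*} [Field k] {N n : ℕ}
    (p : Fin n → (Fin (N + 1) → k)) (m : Fin n → ℕ) (t : ℕ) : ℝ :=
  (alpha (fatIdeal p fun j => t * m j) : ℝ) / t

/-- `P` holds for `n`-tuples of points of `P^N` in general position: there is a
nonempty Zariski-open subset (the complement of the zero locus of a set `S` of
polynomials in the coordinates of the tuple) of tuples of nonzero coordinate
vectors on which `P` holds. -/
def Generic (k : Type*) [Field k] (N n : ℕ)
    (P : (Fin n → (Fin (N + 1) → k)) → Prop) : Prop :=
  ∃ S : Set (MvPolynomial (Fin n × Fin (N + 1)) k),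
    (∃ p : Fin n → (Fin (N + 1) → k), (∀ j, p j ≠ 0) ∧
      ∃ f ∈ S, eval (fun q => p q.1 q.2) f ≠ 0) ∧
    ∀ p : Fin n → (Fin (N + 1) → k), (∀ j, p j ≠ 0) →
      (∃ f ∈ S, eval (fun q => p q.1 q.2) f ≠ 0) → P p



universe u

theorem isJacobsonRing_int : IsJacobsonRing ℤ := by
  rw [isJacobsonRing_iff_prime_eq]
  intro P hP
  by_cases h : P = ⊥
  · subst h
    refine le_antisymm ?_ Ideal.le_jacobson
    intro x hx
    rw [Ideal.mem_jacobson_bot] at hx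
    have := hx 3
    rw [Int.isUnit_iff] at this
    rw [Ideal.mem_bot]
    omega
  · have := hP.isMaximal h
    exact Ideal.jacobson_eq_self_of_isMaximal

/-- Any finite set of elements of a field can be specialised to an algebraically closed field of
positive characteristic. -/
theorem exists_charp_spec {k : Type u} [Field k] (s : Finset k) :
    ∃ (K : Type u) (_ : Field K) (_ : IsAlgClosed K) (p : ℕ) (_ : Fact p.Prime) (_ : CharP K p),
      Nonempty (Algebra.adjoin ℤ (s : Set k) →+* K) := by
  have := isJacobsonRing_int
  set R := Algebra.adjoin ℤ (s : Set k)
  have hft : Algebra.FiniteType ℤ R := Algebra.FiniteType.adjoin_of_finite s.finite_toSet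
  obtain ⟨m, hm⟩ := Ideal.exists_maximal R
  let _ : Field (R ⧸ m) := Ideal.Quotient.field m
  have hft' : Algebra.FiniteType ℤ (R ⧸ m) :=
    Algebra.FiniteType.of_surjective (Ideal.Quotient.mkₐ ℤ m) (Ideal.Quotient.mkₐ_surjective ℤ m)
  have hfin : Module.Finite ℤ (R ⧸ m) := finite_of_finite_type_of_isJacobsonRing ℤ (R ⧸ m)
  let K := AlgebraicClosure (R ⧸ m)
  obtain ⟨p, hp⟩ := CharP.exists (R ⧸ m)
  have hpK : CharP K p := charP_of_injective_algebraMap (algebraMap (R ⧸ m) K).injective p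
  have hp0 : p ≠ 0 := by
    rintro rfl
    have : CharZero (R ⧸ m) := CharP.charP_to_charZero _
    have hintegral : Algebra.IsIntegral ℤ (R ⧸ m) := inferInstance
    have : IsField ℤ := isField_of_isIntegral_of_isField (R := ℤ) (S := R ⧸ m)
      (by intro a b h; simpa using h) (Field.toIsField _)
    exact Int.not_isField this
  have hpp : p.Prime := (CharP.char_is_prime_or_zero (R ⧸ m) p).resolve_right hp0
  exact ⟨K, inferInstance, inferInstance, p, ⟨hpp⟩, hpK,
    ⟨(algebraMap (R ⧸ m) K).comp (Ideal.Quotient.mk m)⟩⟩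

/-- The (inhomogeneous) ideal of the affine point `q`. -/
noncomputable def affIdeal {R : Type*} [CommRing R] {σ : Type*} (q : σ → R) :
    Ideal (MvPolynomial σ R) :=
  Ideal.span (Set.range fun i => X i - C (q i))

/-- Translation by `q`. -/
noncomputable def shiftHom {R : Type*} [CommRing R] {σ : Type*} (q : σ → R) :
    MvPolynomial σ R →ₐ[R] MvPolynomial σ R :=
  aeval (fun i => X i + C (q i))

theorem shiftHom_neg_comp {R : Type*} [CommRing R] {σ : Type*} (q : σ → R) :
    (shiftHom (-q)).comp (shiftHom q) = AlgHom.id R _ := by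
  ext i : 1
  simp [shiftHom]

/-- Translation as an equivalence. -/
noncomputable def shiftEquiv {R : Type*} [CommRing R] {σ : Type*} (q : σ → R) :
    MvPolynomial σ R ≃ₐ[R] MvPolynomial σ R :=
  AlgEquiv.ofAlgHom (shiftHom q) (shiftHom (-q))
    (by simpa using shiftHom_neg_comp (-q)) (shiftHom_neg_comp q)

theorem mem_affIdeal_pow_iff {R : Type*} [CommRing R] {σ : Type*} (q : σ → R) (M : ℕ)
    (f : MvPolynomial σ R) :
    f ∈ affIdeal q ^ M ↔ ∀ β : σ →₀ ℕ, β.degree < M → coeff β (shiftHom q f) = 0 := by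
  rw [← mem_pow_idealOfVars_iff']
  have h1 : (affIdeal q).map (shiftEquiv q).toRingEquiv = idealOfVars σ R := by
    rw [affIdeal, Ideal.map_span, idealOfVars, ← Set.range_comp]
    congr 2
    ext i : 1
    simp [shiftEquiv, shiftHom]
  rw [← h1, ← Ideal.map_pow]
  have := Ideal.mem_map_of_equiv (I := affIdeal q ^ M) (shiftEquiv q).toRingEquiv (shiftHom q f)
  rw [this]
  constructor
  · intro h
    exact ⟨f, h, rfl⟩
  · rintro ⟨x, hx, hxe⟩
    have : x = f := (shiftEquiv q).injective hxe
    exact this ▸ hx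

/-! ### Frobenius -/

section Frob
variable {K : Type*} [Field K] (p : ℕ) [Fact p.Prime] [CharP K p] [PerfectRing K p]
variable {σ : Type*}

/-- componentwise quotient -/
noncomputable def fdiv (q : ℕ) (d : σ →₀ ℕ) : σ →₀ ℕ := d.mapRange (· / q) (Nat.zero_div q)
/-- componentwise remainder -/
noncomputable def fmod (q : ℕ) (d : σ →₀ ℕ) : σ →₀ ℕ := d.mapRange (· % q) (Nat.zero_mod q)

theorem fdiv_add_fmod (q : ℕ) (d : σ →₀ ℕ) : q • fdiv q d + fmod q d = d := by
  ext i
  simp [fdiv, fmod, Nat.div_add_mod]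

theorem fmod_add (q : ℕ) (d e : σ →₀ ℕ) : fmod q (q • e + d) = fmod q d := by
  ext i
  simp [fmod]

theorem fdiv_add {q : ℕ} (hq : 0 < q) (d e : σ →₀ ℕ) : fdiv q (q • e + d) = e + fdiv q d := by
  ext i
  simp [fdiv, Nat.mul_add_div hq]

theorem degree_fdiv_le (q : ℕ) (d : σ →₀ ℕ) : q * (fdiv q d).degree ≤ d.degree := by
  conv_rhs => rw [← fdiv_add_fmod q d]
  rw [map_add, map_nsmul, smul_eq_mul]
  omega

open Classical in
/-- The Cartier-like operator extracting the `β`-th coordinate over `q`-th powers. -/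
noncomputable def cartier (e : ℕ) (β : σ →₀ ℕ) : MvPolynomial σ K →+ MvPolynomial σ K :=
  (Finsupp.liftAddHom (fun δ : σ →₀ ℕ =>
    if fmod (p ^ e) δ = β then
      ((monomial (fdiv (p ^ e) δ)).toAddMonoidHom : K →+ MvPolynomial σ K).comp
        ((iterateFrobeniusEquiv K p e).symm : K →+* K).toAddMonoidHom
    else 0)).comp (AddMonoidAlgebra.coeffAddEquiv).toAddMonoidHom


open Classical in
theorem cartier_monomial (e : ℕ) (β δ : σ →₀ ℕ) (c : K) :
    cartier p e β (monomial δ c) = if fmod (p ^ e) δ = β then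
      monomial (fdiv (p ^ e) δ) ((iterateFrobeniusEquiv K p e).symm c) else 0 := by
  have h : (AddMonoidAlgebra.coeffAddEquiv (monomial δ c : MvPolynomial σ K)) =
    Finsupp.single δ c := rfl
  simp only [cartier, AddMonoidHom.comp_apply, AddEquiv.coe_toAddMonoidHom, h]
  erw [Finsupp.liftAddHom_apply_single]
  split_ifs <;> simp

theorem cartier_pow_mul (e : ℕ) (β : σ →₀ ℕ) (g f : MvPolynomial σ K) :
    cartier p e β (g ^ p ^ e * f) = g * cartier p e β f := by
  classical
  have hq : 0 < p ^ e := pow_pos (Fact.out (p := p.Prime)).pos e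
  induction g using MvPolynomial.induction_on' with
  | add g g' h h' => rw [add_pow_char_pow, add_mul, add_mul, map_add, h, h']
  | monomial u a =>
    induction f using MvPolynomial.induction_on' with
    | add f f' h h' => rw [mul_add, map_add, h, h', map_add, mul_add]
    | monomial d c =>
      rw [monomial_pow, monomial_mul, cartier_monomial, cartier_monomial, fmod_add]
      split_ifs with h
      · rw [fdiv_add hq, monomial_mul, map_mul]
        congr 2
        rw [← iterateFrobeniusEquiv_def K p e a, RingEquiv.symm_apply_apply]
      · rw [mul_zero]

theorem coeff_cartier (e : ℕ) (δ₀ : σ →₀ ℕ) (f : MvPolynomial σ K) :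
    coeff (fdiv (p ^ e) δ₀) (cartier p e (fmod (p ^ e) δ₀) f) =
      (iterateFrobeniusEquiv K p e).symm (coeff δ₀ f) := by
  classical
  induction f using MvPolynomial.induction_on' with
  | add f f' h h' => rw [map_add, coeff_add, h, h', coeff_add, map_add]
  | monomial d c =>
    rw [cartier_monomial, coeff_monomial]
    by_cases hd : d = δ₀
    · subst hd
      simp
    · rw [if_neg hd, map_zero]
      split_ifs with h
      · rw [coeff_monomial, if_neg]
        intro h2
        apply hd
        rw [← fdiv_add_fmod (p ^ e) d, h, h2, fdiv_add_fmod]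
      · simp

theorem totalDegree_cartier (e : ℕ) (β : σ →₀ ℕ) (f : MvPolynomial σ K) :
    p ^ e * (cartier p e β f).totalDegree ≤ f.totalDegree := by
  classical
  have hq : 0 < p ^ e := pow_pos (Fact.out (p := p.Prime)).pos e
  rw [mul_comm, ← Nat.le_div_iff_mul_le hq]
  conv_lhs => rw [f.as_sum, map_sum]
  refine (totalDegree_finsetSum _ _).trans (Finset.sup_le ?_)
  intro d hd
  rw [cartier_monomial]
  split_ifs
  · refine (totalDegree_monomial_le _ _).trans ?_
    rw [Nat.le_div_iff_mul_le hq, mul_comm]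
    refine (degree_fdiv_le (p ^ e) d).trans ?_
    exact le_totalDegree hd
  · simp

theorem cartier_mem {N : ℕ} (e m : ℕ) (β : Fin N →₀ ℕ) (z : Fin N → K)
    (f : MvPolynomial (Fin N) K) (hf : f ∈ affIdeal z ^ (p ^ e * (m + N))) :
    cartier p e β f ∈ affIdeal z ^ m := by
  classical
  have hq : 0 < p ^ e := pow_pos (Fact.out (p := p.Prime)).pos e
  rw [affIdeal, Ideal.mem_span_pow_iff_exists_isHomogeneous] at hf
  obtain ⟨P, hP, rfl⟩ := hf
  rw [eval_eq', map_sum]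
  refine Ideal.sum_mem _ fun d hd => ?_
  have hdeg : d.degree = p ^ e * (m + N) := by
    by_contra h
    exact (mem_support_iff.mp hd) (hP.coeff_eq_zero h)
  have hsplit : coeff d P * ∏ i, (X i - C (z i)) ^ d i =
      (∏ i, (X i - C (z i)) ^ (d i / p ^ e)) ^ p ^ e *
        (coeff d P * ∏ i, (X i - C (z i)) ^ (d i % p ^ e)) := by
    rw [← Finset.prod_pow, mul_left_comm, ← Finset.prod_mul_distrib]
    congr 1
    refine Finset.prod_congr rfl fun i _ => ?_
    rw [← pow_mul, ← pow_add]
    congr 1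
    rw [mul_comm, Nat.div_add_mod]
  rw [hsplit, cartier_pow_mul]
  refine Ideal.mul_mem_right _ _ ?_
  have hsum : m ≤ ∑ i, d i / p ^ e := by
    have h1 : p ^ e * (m + N) ≤ p ^ e * (∑ i, d i / p ^ e + N) := by
      rw [← hdeg, Finsupp.degree_eq_sum, mul_add, Finset.mul_sum]
      calc ∑ i, d i ≤ ∑ i : Fin N, (p ^ e * (d i / p ^ e) + p ^ e) := by
            refine Finset.sum_le_sum fun i _ => ?_
            have := Nat.div_add_mod (d i) (p ^ e)
            have := Nat.mod_lt (d i) hq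
            omega
        _ = _ := by simp [Finset.sum_add_distrib, mul_comm]
    have := Nat.le_of_mul_le_mul_left h1 hq
    omega
  refine Ideal.pow_le_pow_right hsum ?_
  rw [← Finset.prod_pow_eq_pow_sum]
  refine Ideal.prod_mem_prod fun i _ => Ideal.pow_mem_pow ?_ _
  exact Ideal.subset_span ⟨i, rfl⟩

end Frob

/-- In characteristic `p`, an initial degree bound for one `m` propagates to all multiplicities. -/
theorem charp_bound {K : Type*} [Field K] (p : ℕ) [Fact p.Prime] [CharP K p] [PerfectRing K p]
    {N n : ℕ} (z : Fin n → Fin N → K) (m D : ℕ)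
    (H : ∀ g : MvPolynomial (Fin N) K, g.totalDegree < D → (∀ j, g ∈ affIdeal (z j) ^ m) → g = 0)
    (f : MvPolynomial (Fin N) K) (hf0 : f ≠ 0) (M : ℕ) (hf : ∀ j, f ∈ affIdeal (z j) ^ M) :
    M * D ≤ f.totalDegree * (m + N) := by
  classical
  have hp := (Fact.out (p := p.Prime))
  have key : ∀ (e : ℕ) (f : MvPolynomial (Fin N) K), f ≠ 0 →
      (∀ j, f ∈ affIdeal (z j) ^ (p ^ e * (m + N))) → p ^ e * D ≤ f.totalDegree := by
    intro e f hf0 hf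
    obtain ⟨δ, hδ⟩ := MvPolynomial.ne_zero_iff.mp hf0
    have hne : cartier p e (fmod (p ^ e) δ) f ≠ 0 := by
      intro h
      have := coeff_cartier p e δ f
      rw [h, coeff_zero] at this
      exact hδ (by simpa using this.symm)
    have h2 : D ≤ (cartier p e (fmod (p ^ e) δ) f).totalDegree := by
      by_contra hlt
      exact hne (H _ (not_le.mp hlt) fun j => cartier_mem p e m _ _ _ (hf j))
    exact (Nat.mul_le_mul_left _ h2).trans (totalDegree_cartier p e _ f)
  rcases Nat.eq_zero_or_pos M with rfl | hM
  · simp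
  have key2 : ∀ e : ℕ, p ^ e * (M * D) ≤ (p ^ e * (m + N) + M) * f.totalDegree := by
    intro e
    set A := p ^ e * (m + N) with hA
    have h3 := key e (f ^ (A / M + 1)) (pow_ne_zero _ hf0) (fun j => by
      have h4 := Ideal.pow_mem_pow (hf j) (A / M + 1)
      rw [← pow_mul] at h4
      refine Ideal.pow_le_pow_right ?_ h4
      have := Nat.div_add_mod A M
      have := Nat.mod_lt A hM
      have h8 : M * (A / M + 1) = M * (A / M) + M := by ring
      omega)
    have h5 : (f ^ (A / M + 1)).totalDegree ≤ (A / M + 1) * f.totalDegree := totalDegree_pow _ _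
    calc p ^ e * (M * D) = M * (p ^ e * D) := by ring
      _ ≤ M * ((A / M + 1) * f.totalDegree) := Nat.mul_le_mul_left _ (h3.trans h5)
      _ = (M * (A / M) + M) * f.totalDegree := by ring
      _ ≤ _ := Nat.mul_le_mul_right _ (by have := Nat.mul_div_le A M; omega)
  by_contra hlt
  rw [not_le] at hlt
  have h6 := key2 (M * f.totalDegree + 1)
  have h7 : M * f.totalDegree + 1 < p ^ (M * f.totalDegree + 1) := Nat.lt_pow_self hp.one_lt
  set Q := p ^ (M * f.totalDegree + 1)
  nlinarith

/-! ### Multiplicity Schwartz-Zippel on a grid -/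

theorem grid_layer {k R : Type*} [Field k] [CommRing R] [Algebra k R] (S : Finset k)
    (n : Ideal R) (g : Polynomial R) (q b : ℕ) (hdeg : g.natDegree < S.card * (q + 1))
    (h : ∀ c ∈ S, g ∈ (n.map Polynomial.C ⊔
      Ideal.span {Polynomial.X - Polynomial.C (algebraMap k R c)}) ^ (b + (q + 1))) :
    g.leadingCoeff ∈ n ^ b := by
  classical
  rcases subsingleton_or_nontrivial (R ⧸ n ^ b) with hsub | hnon
  · rw [Ideal.Quotient.subsingleton_iff] at hsub
    simp [hsub]
  set φ := Ideal.Quotient.mk (n ^ b) with hφ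
  have hdvd : ∀ c ∈ S, (Polynomial.X - Polynomial.C (φ (algebraMap k R c))) ^ (q + 1) ∣
      g.map φ := by
    intro c hc
    have h1 := Ideal.sup_pow_add_le_pow_sup_pow (h c hc)
    rw [← Ideal.map_pow, Ideal.span_singleton_pow] at h1
    obtain ⟨u, hu, v, hv, huv⟩ := Submodule.mem_sup.mp h1
    have hu0 : u.map φ = 0 := by
      ext i
      rw [Polynomial.coeff_map, Polynomial.coeff_zero, hφ, Ideal.Quotient.eq_zero_iff_mem]
      exact Ideal.mem_map_C_iff.mp hu i
    obtain ⟨w, rfl⟩ := Ideal.mem_span_singleton'.mp hv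
    rw [← huv, Polynomial.map_add, hu0, zero_add, Polynomial.map_mul]
    exact Dvd.intro_left (w.map φ) (by simp)
  have hcop : (S : Set k).Pairwise (Function.onFun IsCoprime fun c =>
      (Polynomial.X - Polynomial.C (φ (algebraMap k R c))) ^ (q + 1)) := by
    intro c _ c' _ hcc'
    refine IsCoprime.pow ?_
    apply Polynomial.isCoprime_X_sub_C_of_isUnit_sub
    rw [← map_sub, ← map_sub]
    exact ((IsUnit.mk0 _ (sub_ne_zero.mpr hcc')).map (algebraMap k R)).map φ
  have hall := Finset.prod_dvd_of_coprime hcop hdvd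
  have hmon : ∀ c ∈ S, ((Polynomial.X - Polynomial.C (φ (algebraMap k R c))) ^ (q + 1)).Monic :=
    fun c _ => (Polynomial.monic_X_sub_C _).pow _
  have hzero : g.map φ = 0 := by
    by_contra hne
    refine Polynomial.Monic.not_dvd_of_natDegree_lt (Polynomial.monic_prod_of_monic _ _ hmon)
      hne ?_ hall
    rw [Polynomial.natDegree_prod_of_monic _ _ hmon]
    refine lt_of_le_of_lt Polynomial.natDegree_map_le (hdeg.trans_le ?_)
    rw [← smul_eq_mul, ← Finset.sum_const]
    refine Finset.sum_le_sum fun c _ => ?_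
    rw [(Polynomial.monic_X_sub_C _).natDegree_pow]
    simp
  have := congrArg (fun x => Polynomial.coeff x g.natDegree) hzero
  simp only [Polynomial.coeff_map, Polynomial.coeff_zero] at this
  exact Ideal.Quotient.eq_zero_iff_mem.mp this

theorem grid_zero {k : Type*} [Field k] (S : Finset k) : ∀ (N m : ℕ)
    (f : MvPolynomial (Fin N) k), f.totalDegree < S.card * (m - N) →
    (∀ z : Fin N → k, (∀ i, z i ∈ S) → f ∈ affIdeal z ^ m) → f = 0 := by
  intro N
  induction N with
  | zero =>
    intro m f hdeg h
    have h1 := h (fun i => i.elim0) (fun i => i.elim0)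
    have hm : m ≠ 0 := by rintro rfl; simp at hdeg
    have : affIdeal (fun i => i.elim0 : Fin 0 → k) = ⊥ := by
      rw [affIdeal, Set.range_eq_empty, Ideal.span_empty]
    rw [this, ← Ideal.zero_eq_bot, zero_pow hm] at h1
    simpa using h1
  | succ N ih =>
    intro m f hdeg h
    by_contra hf
    set g := finSuccEquiv k N f with hg
    have hg0 : g ≠ 0 := by simpa [hg] using hf
    set l := g.natDegree with hl
    set a := S.card with ha
    have ha0 : 0 < a := Nat.pos_of_ne_zero (by intro h0; simp [h0] at hdeg)
    have hlc : g.coeff l ≠ 0 := by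
      rw [hl]; exact Polynomial.leadingCoeff_ne_zero.mpr hg0
    have hdl : (g.coeff l).totalDegree + l ≤ f.totalDegree :=
      totalDegree_coeff_finSuccEquiv_add_le f l hlc
    obtain ⟨q, hq1, hq2⟩ : ∃ q, a * q ≤ l ∧ l < a * (q + 1) :=
      ⟨l / a, Nat.mul_div_le l a, Nat.lt_mul_div_succ l ha0⟩
    have hqm : q < m - (N + 1) := by
      have : a * q < a * (m - (N + 1)) := by omega
      exact Nat.lt_of_mul_lt_mul_left this
    obtain ⟨b, hb⟩ : ∃ b, m = b + (q + 1) := ⟨m - (q + 1), by omega⟩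
    apply hlc
    apply ih b
    · have : m - (N + 1) = (b - N) + q := by omega
      rw [this, mul_add] at hdeg
      omega
    · intro z hz
      refine grid_layer S (affIdeal z) g q b hq2 ?_
      intro c hc
      have h2 := h (Fin.cons c z) (by
        intro i
        refine Fin.cases ?_ ?_ i
        · simpa using hc
        · intro i; simpa using hz i)
      have h3 := Ideal.mem_map_of_mem (finSuccEquiv k N).toRingEquiv h2
      rw [Ideal.map_pow, hb] at h3
      refine Ideal.pow_right_mono ?_ _ h3
      rw [affIdeal, Ideal.map_span, Ideal.span_le]
      rintro _ ⟨_, ⟨i, rfl⟩, rfl⟩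
      refine Fin.cases ?_ ?_ i
      · refine Ideal.mem_sup_right (Ideal.subset_span ?_)
        simp only [Fin.cons_zero, Set.mem_singleton_iff]
        change finSuccEquiv k N _ = _
        rw [map_sub, finSuccEquiv_X_zero, finSuccEquiv_apply]
        simp
      · intro i
        refine Ideal.mem_sup_left ?_
        have : (finSuccEquiv k N).toRingEquiv (X i.succ - C ((Fin.cons c z : Fin (N + 1) → k) i.succ)) =
            Polynomial.C (X i - C (z i)) := by
          change finSuccEquiv k N _ = _
          rw [map_sub, finSuccEquiv_X_succ, finSuccEquiv_apply]
          simp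
        rw [this]
        exact Ideal.mem_map_of_mem _ (Ideal.subset_span ⟨i, rfl⟩)

/-! ### Matrices of jets, openness and transfer to positive characteristic -/

theorem exists_left_inv {k ι κ : Type*} [Field k] [Fintype ι] [Fintype κ] [DecidableEq ι]
    [DecidableEq κ] (A : Matrix ι κ k) (h : ∀ v, A.mulVec v = 0 → v = 0) :
    ∃ B : Matrix κ ι k, B * A = 1 := by
  obtain ⟨g, hg⟩ := LinearMap.exists_leftInverse_of_injective (Matrix.toLin' A)
    (LinearMap.ker_eq_bot'.mpr fun v hv => h v (by simpa using hv))
  refine ⟨LinearMap.toMatrix' g, ?_⟩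
  have := congrArg LinearMap.toMatrix' hg
  rwa [LinearMap.toMatrix'_comp, LinearMap.toMatrix'_toLin', LinearMap.toMatrix'_id] at this

theorem inj_of_left_inv {R ι κ : Type*} [CommRing R] [Fintype ι] [Fintype κ] [DecidableEq κ]
    (A : Matrix ι κ R) (B : Matrix κ ι R) (h : B * A = 1) (v : κ → R) (hv : A.mulVec v = 0) :
    v = 0 := by
  have : (B * A).mulVec v = 0 := by rw [← Matrix.mulVec_mulVec, hv, Matrix.mulVec_zero]
  simpa [h] using this

theorem matrix_open {k ι κ τ : Type*} [Field k] [Fintype ι] [Fintype κ] [DecidableEq ι]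
    [DecidableEq κ] (A : Matrix ι κ (MvPolynomial τ k)) (x₀ : τ → k)
    (h : ∀ v, (A.map (eval x₀)).mulVec v = 0 → v = 0) :
    ∃ Δ : MvPolynomial τ k, eval x₀ Δ ≠ 0 ∧ ∀ x, eval x Δ ≠ 0 →
      ∀ v, (A.map (eval x)).mulVec v = 0 → v = 0 := by
  obtain ⟨B, hB⟩ := exists_left_inv _ h
  have hdet : ∀ x, eval x ((B.map C : Matrix κ ι (MvPolynomial τ k)) * A).det = (B * A.map (eval x)).det := by
    intro x
    rw [RingHom.map_det, RingHom.mapMatrix_apply, Matrix.map_mul, Matrix.map_map]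
    congr 2
    ext i j
    simp
  refine ⟨((B.map C : Matrix κ ι (MvPolynomial τ k)) * A).det, ?_, ?_⟩
  · rw [hdet, hB]; simp
  · intro x hx v hv
    rw [hdet] at hx
    have h1 : (B * A.map (eval x)).mulVec v = 0 := by
      rw [← Matrix.mulVec_mulVec, hv, Matrix.mulVec_zero]
    exact Matrix.eq_zero_of_mulVec_eq_zero hx h1

/-- Exponents of degree less than `D`. -/
noncomputable def expLT (N D : ℕ) : Finset (Fin N →₀ ℕ) :=
  (Finsupp.finite_of_degree_le (σ := Fin N) D).toFinset.filter (fun γ => γ.degree < D)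

theorem mem_expLT {N D : ℕ} {γ : Fin N →₀ ℕ} : γ ∈ expLT N D ↔ γ.degree < D := by
  simp only [expLT, Finset.mem_filter, Set.Finite.mem_toFinset, Set.mem_ofPred_eq]
  omega

theorem map_shiftHom {R R' : Type*} [CommRing R] [CommRing R'] (φ : R →+* R') {σ : Type*}
    (q : σ → R) (f : MvPolynomial σ R) :
    map φ (shiftHom q f) = shiftHom (fun i => φ (q i)) (map φ f) := by
  induction f using MvPolynomial.induction_on with
  | C a => simp [shiftHom]
  | add f g hf hg => simp [hf, hg]
  | mul_X f i hf => simp [hf]; simp [shiftHom]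

/-- The matrix of jets of order less than `m` at the points `q j` on polynomials of degree `< D`. -/
noncomputable def jetMat {R : Type*} [CommRing R] {n N : ℕ} (q : Fin n → Fin N → R) (m D : ℕ) :
    Matrix (Fin n × expLT N m) (expLT N D) R :=
  fun x γ => coeff x.2.1 (shiftHom (q x.1) (monomial γ.1 1))

theorem jetMat_map {R R' : Type*} [CommRing R] [CommRing R'] (φ : R →+* R') {n N : ℕ}
    (q : Fin n → Fin N → R) (m D : ℕ) :
    (jetMat q m D).map φ = jetMat (fun j i => φ (q j i)) m D := by
  ext x γ
  simp only [jetMat, Matrix.map_apply]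
  rw [← coeff_map, map_shiftHom, map_monomial, map_one]

theorem sum_monomial_expLT {R : Type*} [CommRing R] {N D : ℕ} (f : MvPolynomial (Fin N) R)
    (hf : f.totalDegree < D) : f = ∑ γ : expLT N D, monomial γ.1 (coeff γ.1 f) := by
  classical
  rw [Finset.sum_coe_sort (expLT N D) (fun γ => monomial γ (coeff γ f))]
  conv_lhs => rw [f.as_sum]
  refine Finset.sum_subset ?_ ?_
  · intro γ hγ
    rw [mem_expLT]
    exact lt_of_le_of_lt (le_totalDegree hγ) hf
  · intro γ _ hγ
    rw [notMem_support_iff.mp hγ, monomial_zero]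

theorem jetMat_mulVec {R : Type*} [CommRing R] {n N : ℕ} (q : Fin n → Fin N → R) (m D : ℕ)
    (v : expLT N D → R) (x : Fin n × expLT N m) :
    (jetMat q m D).mulVec v x = coeff x.2.1 (shiftHom (q x.1) (∑ γ, monomial γ.1 (v γ))) := by
  rw [map_sum, coeff_sum, Matrix.mulVec, dotProduct]
  refine Finset.sum_congr rfl fun γ _ => ?_
  have : (monomial γ.1 (v γ) : MvPolynomial (Fin N) R) = v γ • monomial γ.1 1 := by
    rw [smul_monomial, smul_eq_mul, mul_one]
  rw [this, map_smul, coeff_smul, jetMat, smul_eq_mul, mul_comm]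

/-- No nonzero polynomial of degree `< D` vanishes to order `m` at all the points. -/
def JetCond {R : Type*} [CommRing R] {n N : ℕ} (q : Fin n → Fin N → R) (m D : ℕ) : Prop :=
  ∀ g : MvPolynomial (Fin N) R, g.totalDegree < D → (∀ j, g ∈ affIdeal (q j) ^ m) → g = 0

theorem jetCond_of_inj {R : Type*} [CommRing R] {n N : ℕ} (q : Fin n → Fin N → R) (m D : ℕ)
    (h : ∀ v, (jetMat q m D).mulVec v = 0 → v = 0) : JetCond q m D := by
  intro g hg hmem
  have h1 := h (fun γ => coeff γ.1 g) (by
    ext x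
    rw [jetMat_mulVec, ← sum_monomial_expLT g hg]
    exact (mem_affIdeal_pow_iff _ _ _).mp (hmem x.1) x.2.1 (mem_expLT.mp x.2.2))
  rw [sum_monomial_expLT g hg]
  refine Finset.sum_eq_zero fun γ _ => ?_
  have := congrFun h1 γ
  simp only [Pi.zero_apply] at this
  rw [this, monomial_zero]

theorem inj_of_jetCond {R : Type*} [CommRing R] {n N : ℕ} (q : Fin n → Fin N → R) (m D : ℕ)
    (h : JetCond q m D) (v : expLT N D → R) (hv : (jetMat q m D).mulVec v = 0) : v = 0 := by
  classical
  rcases Nat.eq_zero_or_pos D with rfl | hD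
  · ext γ
    exact absurd (mem_expLT.mp γ.2) (by omega)
  have h1 := h (∑ γ, monomial γ.1 (v γ)) (by
    refine lt_of_le_of_lt (totalDegree_finsetSum _ _) ?_
    rw [Finset.sup_lt_iff (by simpa using hD)]
    intro γ _
    exact lt_of_le_of_lt (totalDegree_monomial_le _ _) (mem_expLT.mp γ.2)) (by
    intro j
    rw [mem_affIdeal_pow_iff]
    intro β hβ
    have := congrFun hv (j, ⟨β, mem_expLT.mpr hβ⟩)
    rwa [jetMat_mulVec] at this)
  ext γ
  have h2 := congrArg (coeff γ.1) h1
  rw [coeff_sum, coeff_zero, Finset.sum_eq_single γ] at h2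
  · simpa using h2
  · intro δ _ hδ
    rw [coeff_monomial, if_neg]
    exact fun h => hδ (Subtype.ext h)
  · simp

theorem jet_open {k : Type*} [Field k] {n N : ℕ} (q₀ : Fin n → Fin N → k) (m D : ℕ)
    (h : JetCond q₀ m D) :
    ∃ Δ : MvPolynomial (Fin n × Fin N) k, Δ ≠ 0 ∧
      ∀ q : Fin n → Fin N → k, eval (fun x => q x.1 x.2) Δ ≠ 0 → JetCond q m D := by
  classical
  set A := jetMat (fun (j : Fin n) (i : Fin N) => (X (j, i) : MvPolynomial (Fin n × Fin N) k)) m D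
    with hA
  have hAq : ∀ q : Fin n → Fin N → k, A.map (eval (fun x => q x.1 x.2)) = jetMat q m D := by
    intro q
    rw [hA, jetMat_map]
    simp
  obtain ⟨Δ, h0, h1⟩ := matrix_open A (fun x => q₀ x.1 x.2) (by
    rw [hAq]; exact inj_of_jetCond q₀ m D h)
  refine ⟨Δ, by rintro rfl; simp at h0, fun q hq => jetCond_of_inj q m D ?_⟩
  rw [← hAq]
  exact h1 _ hq

/-- The one-multiplicity bound propagates to all multiplicities over any field, by
specialisation to positive characteristic. -/
theorem jet_bound {k : Type u} [Field k] {n N : ℕ} (q : Fin n → Fin N → k) (m D : ℕ)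
    (h : JetCond q m D) (f : MvPolynomial (Fin N) k) (hf0 : f ≠ 0) (M : ℕ)
    (hf : ∀ j, f ∈ affIdeal (q j) ^ M) : M * D ≤ f.totalDegree * (m + N) := by
  classical
  obtain ⟨B, hB⟩ := exists_left_inv _ (inj_of_jetCond q m D h)
  obtain ⟨δ, hδ⟩ := MvPolynomial.ne_zero_iff.mp hf0
  let s : Finset k := (Finset.univ.image fun x : Fin n × Fin N => q x.1 x.2) ∪
    (f.support.image fun d => coeff d f) ∪
    (Finset.univ.image fun x : (expLT N D) × (Fin n × expLT N m) => B x.1 x.2) ∪ {(coeff δ f)⁻¹}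
  obtain ⟨K, _, _, p, _, _, ⟨φ⟩⟩ := exists_charp_spec s
  set R := Algebra.adjoin ℤ (s : Set k) with hR
  have hs : ∀ x ∈ s, x ∈ R := fun x hx => Algebra.subset_adjoin hx
  have hq : ∀ j i, q j i ∈ R := fun j i => hs _ (by
    simp only [s, Finset.mem_union, Finset.mem_image, Finset.mem_univ, true_and]
    exact Or.inl (Or.inl (Or.inl ⟨(j, i), rfl⟩)))
  have hBR : ∀ x y, B x y ∈ R := fun x y => hs _ (by
    simp only [s, Finset.mem_union, Finset.mem_image, Finset.mem_univ, true_and]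
    exact Or.inl (Or.inr ⟨(x, y), rfl⟩))
  have hfR : ∀ d, coeff d f ∈ R := fun d => by
    by_cases hd : coeff d f = 0
    · rw [hd]; exact R.zero_mem
    · refine hs _ ?_
      simp only [s, Finset.mem_union, Finset.mem_image, Finset.mem_univ, true_and]
      exact Or.inl (Or.inl (Or.inr ⟨d, mem_support_iff.mpr hd, rfl⟩))
  have hinv : (coeff δ f)⁻¹ ∈ R := hs _ (by simp [s])
  let ι : R →+* k := R.val.toRingHom
  have hι : Function.Injective ι := Subtype.val_injective
  let q' : Fin n → Fin N → R := fun j i => ⟨q j i, hq j i⟩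
  let B' : Matrix (expLT N D) (Fin n × expLT N m) R := fun x y => ⟨B x y, hBR x y⟩
  let f' : MvPolynomial (Fin N) R := ∑ d ∈ f.support, monomial d ⟨coeff d f, hfR d⟩
  have hf' : map ι f' = f := by
    conv_rhs => rw [f.as_sum]
    simp only [f', map_sum, map_monomial]
    rfl
  have hBA : B' * jetMat q' m D = 1 := by
    have : (B' * jetMat q' m D).map ι = (1 : Matrix (expLT N D) (expLT N D) R).map ι := by
      rw [Matrix.map_mul, jetMat_map, Matrix.map_one _ ι.map_zero ι.map_one]
      exact hB
    exact Matrix.map_injective hι this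
  have hBAK : B'.map φ * jetMat (fun j i => φ (q' j i)) m D = 1 := by
    rw [← jetMat_map, ← Matrix.map_mul, hBA, Matrix.map_one _ φ.map_zero φ.map_one]
  have hcond : JetCond (fun j i => φ (q' j i)) m D :=
    jetCond_of_inj _ _ _ (inj_of_left_inv _ _ hBAK)
  have hcoeff : ∀ d, ι (coeff d f') = coeff d f := fun d => by rw [← coeff_map, hf']
  have hfK0 : map φ f' ≠ 0 := by
    intro h0
    have h1 : φ (coeff δ f') = 0 := by rw [← coeff_map, h0, coeff_zero]
    have h2 : coeff δ f' * (⟨(coeff δ f)⁻¹, hinv⟩ : R) = 1 := by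
      apply hι
      rw [map_mul, hcoeff, map_one]
      exact mul_inv_cancel₀ hδ
    have h3 := congrArg φ h2
    rw [map_mul, h1, zero_mul, map_one] at h3
    exact zero_ne_one h3
  have hmemR : ∀ j, f' ∈ affIdeal (q' j) ^ M := by
    intro j
    rw [mem_affIdeal_pow_iff]
    intro β hβ
    apply hι
    rw [← coeff_map, map_shiftHom, hf', map_zero]
    exact (mem_affIdeal_pow_iff _ _ _).mp (hf j) β hβ
  have hmemK : ∀ j, map φ f' ∈ affIdeal (fun i => φ (q' j i)) ^ M := by
    intro j
    rw [mem_affIdeal_pow_iff]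
    intro β hβ
    rw [← map_shiftHom, coeff_map, (mem_affIdeal_pow_iff _ _ _).mp (hmemR j) β hβ, map_zero]
  have hfin := charp_bound p (fun j i => φ (q' j i)) m D hcond (map φ f') hfK0 M hmemK
  refine hfin.trans (Nat.mul_le_mul_right _ ?_)
  refine Finset.sup_mono ?_
  intro d hd
  rw [mem_support_iff, coeff_map] at hd
  rw [mem_support_iff, ← hcoeff]
  intro h0
  apply hd
  have : coeff d f' = 0 := hι (by rw [h0, map_zero])
  rw [this, map_zero]

/-! ### The grid, the separators and the open set -/

theorem exists_grid (k : Type*) [Field k] [CharZero k] (a n : ℕ) (h : a ^ 3 ≤ n) :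
    ∃ q₀ : Fin n → Fin 3 → k, JetCond q₀ 40 (a * 37) := by
  classical
  refine ⟨fun j i => if hj : j.1 < a ^ 3 then
    (((finFunctionFinEquiv (m := a) (n := 3)).symm ⟨j.1, hj⟩ i : ℕ) : k) else 0, ?_⟩
  intro g hg hmem
  let S : Finset k := (Finset.range a).map Nat.castEmbedding
  have hS : S.card = a := by simp [S]
  refine grid_zero S 3 40 g (by rw [hS]; exact hg) ?_
  intro z hz
  have hz' : ∀ i, ∃ c : Fin a, ((c : ℕ) : k) = z i := by
    intro i
    have := hz i
    simp only [S, Finset.mem_map, Finset.mem_range] at this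
    obtain ⟨c, hc, hcz⟩ := this
    exact ⟨⟨c, hc⟩, hcz⟩
  choose c hc using hz'
  have hlt : (finFunctionFinEquiv c : ℕ) < a ^ 3 := (finFunctionFinEquiv c).2
  have := hmem ⟨finFunctionFinEquiv c, lt_of_lt_of_le hlt h⟩
  convert this using 3
  ext i
  dsimp only
  rw [dif_pos hlt, Fin.eta, Equiv.symm_apply_apply, hc]

theorem card_expLT_three (s : ℕ) : (expLT 3 (s + 1)).card = (s + 3).choose 3 := by
  classical
  have h1 : ∀ d, ((expLT 3 (s + 1)).filter (fun γ => γ.degree = d)).card =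
      if d < s + 1 then (d + 2).choose 2 else 0 := by
    intro d
    split_ifs with hd
    · have : ((expLT 3 (s + 1)).filter (fun γ => γ.degree = d)) =
          (Finset.univ : Finset (Fin 3)).finsuppAntidiag d := by
        ext γ
        rw [Finset.mem_filter, mem_expLT, Finset.mem_finsuppAntidiag, Finsupp.degree_eq_sum]
        constructor
        · rintro ⟨_, h⟩; exact ⟨h, Finset.subset_univ _⟩
        · rintro ⟨h, _⟩; exact ⟨by simpa [h] using hd, h⟩
      rw [this, Finset.card_finsuppAntidiag_nat_eq_choose]
      have h3 : (Finset.univ : Finset (Fin 3)).card + d - 1 = d + 2 := by simp; omega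
      rw [h3, Nat.choose_symm_add]
    · rw [Finset.card_eq_zero, Finset.filter_eq_empty_iff]
      intro γ hγ
      rw [mem_expLT] at hγ
      omega
  rw [Finset.card_eq_sum_card_fiberwise (f := fun γ => γ.degree) (t := Finset.range (s + 1))
    (fun γ hγ => by simpa using mem_expLT.mp hγ)]
  rw [Finset.sum_congr rfl (fun d hd => by
    rw [h1, if_pos (Finset.mem_range.mp hd)])]
  clear h1
  induction s with
  | zero => decide
  | succ s ih => rw [Finset.sum_range_succ, ih, Nat.choose_succ_succ' (s + 3) 2, add_comm]

theorem lt_choose (a n : ℕ) (h : n < (a + 1) ^ 3) : n ≤ (2 * a + 3).choose 3 := by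
  have h1 := Nat.descFactorial_eq_factorial_mul_choose (2 * a + 3) 3
  have h2 : (2 * a + 3).descFactorial 3 = (2 * a + 1) * ((2 * a + 2) * (2 * a + 3)) := by
    simp [Nat.descFactorial]
  rw [h2] at h1
  have h3 : Nat.factorial 3 = 6 := rfl
  rw [h3] at h1
  nlinarith [sq_nonneg a, Nat.zero_le (a ^ 3)]

theorem exists_sep_points {k : Type*} [Field k] [Infinite k] (n s : ℕ)
    (h : n ≤ (expLT 3 (s + 1)).card) :
    ∃ q : Fin n → Fin 3 → k,
      LinearIndependent k (fun j => fun γ : expLT 3 (s + 1) => ∏ l, q j l ^ (γ.1 l)) := by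
  classical
  let V := (expLT 3 (s + 1)) → k
  let v : (Fin 3 → k) → V := fun q γ => ∏ l, q l ^ (γ.1 l)
  have hspan : Submodule.span k (Set.range v) = ⊤ := by
    by_contra hne
    obtain ⟨φ, hφ0, hφ⟩ := Submodule.exists_le_ker_of_lt_top _ (lt_top_iff_ne_top.mpr hne)
    apply hφ0
    let g : MvPolynomial (Fin 3) k := ∑ γ : expLT 3 (s + 1), monomial γ.1 (φ (Pi.single γ 1))
    have hφv : ∀ w : V, φ w = ∑ γ, w γ * φ (Pi.single γ 1) := by
      intro w
      conv_lhs => rw [pi_eq_sum_univ' w]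
      rw [map_sum]
      refine Finset.sum_congr rfl fun γ _ => ?_
      rw [map_smul, smul_eq_mul]
    have hg : g = 0 := by
      apply MvPolynomial.funext
      intro q
      have h1 : φ (v q) = 0 := hφ (Submodule.subset_span ⟨q, rfl⟩)
      rw [hφv] at h1
      rw [map_zero, ← h1]
      simp only [g, map_sum, eval_monomial]
      refine Finset.sum_congr rfl fun γ _ => ?_
      rw [mul_comm, Finsupp.prod_fintype _ _ (fun i => pow_zero _)]
    have hc : ∀ γ, φ (Pi.single γ 1) = 0 := by
      intro γ
      have h2 := congrArg (coeff γ.1) hg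
      rw [coeff_sum, coeff_zero, Finset.sum_eq_single γ] at h2
      · simpa using h2
      · intro δ _ hδ
        rw [coeff_monomial, if_neg]
        exact fun h => hδ (Subtype.ext h)
      · simp
    ext γ
    simp [hc γ]
  obtain ⟨b, hb, hbs, hli⟩ := exists_linearIndependent k (Set.range v)
  rw [hspan] at hbs
  let bas : Module.Basis b k V := Module.Basis.mk hli (by rw [Subtype.range_coe, hbs])
  have hfin : Fintype b := FiniteDimensional.fintypeBasisIndex bas
  have hcard : Fintype.card b = (expLT 3 (s + 1)).card := by
    rw [← Module.finrank_eq_card_basis bas, Module.finrank_fintype_fun_eq_card, Fintype.card_coe]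
  obtain ⟨e⟩ : Nonempty (Fin n ↪ b) := Function.Embedding.nonempty_of_card_le (by simpa [hcard] using h)
  choose q hq using fun j => hb (e j).2
  refine ⟨q, ?_⟩
  have := hli.comp e e.injective
  have he : (fun j => fun γ : expLT 3 (s + 1) => ∏ l, q j l ^ (γ.1 l)) =
      (Subtype.val ∘ e : Fin n → V) := _root_.funext fun j => hq j
  rw [he]
  exact this

theorem sep_open {k : Type*} [Field k] [Infinite k] (n s : ℕ)
    (h : n ≤ (expLT 3 (s + 1)).card) :
    ∃ Δ : MvPolynomial (Fin n × Fin 3) k, Δ ≠ 0 ∧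
      ∀ q : Fin n → Fin 3 → k, eval (fun x => q x.1 x.2) Δ ≠ 0 →
        ∃ B : Fin n → expLT 3 (s + 1) → k, ∀ i j,
          ∑ γ, B i γ * ∏ l, q j l ^ (γ.1 l) = if i = j then 1 else 0 := by
  classical
  obtain ⟨q₀, hq₀⟩ := exists_sep_points (k := k) n s h
  let A : Matrix (expLT 3 (s + 1)) (Fin n) (MvPolynomial (Fin n × Fin 3) k) :=
    fun γ j => ∏ l, X (j, l) ^ (γ.1 l)
  have hA : ∀ q : Fin n → Fin 3 → k, A.map (eval (fun x => q x.1 x.2)) =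
      Matrix.of fun γ j => ∏ l, q j l ^ (γ.1 l) := by
    intro q; ext γ j; rw [Matrix.map_apply]; simp [A]
  obtain ⟨Δ, h0, h1⟩ := matrix_open A (fun x => q₀ x.1 x.2) (by
    intro v hv
    rw [hA] at hv
    have := Fintype.linearIndependent_iff.mp hq₀ v (by
      ext γ
      have := congrFun hv γ
      simp only [Matrix.mulVec, dotProduct, Pi.zero_apply, Matrix.of_apply] at this
      simp only [Finset.sum_apply, Pi.smul_apply, smul_eq_mul, Pi.zero_apply]
      rw [← this]
      exact Finset.sum_congr rfl fun j _ => mul_comm _ _)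
    exact _root_.funext this)
  refine ⟨Δ, by rintro rfl; simp at h0, fun q hq => ?_⟩
  obtain ⟨B, hB⟩ := exists_left_inv _ (h1 _ hq)
  refine ⟨B, fun i j => ?_⟩
  rw [hA] at hB
  have := congrFun (congrFun hB i) j
  rw [Matrix.mul_apply, Matrix.one_apply] at this
  exact this

theorem homogenize_open {k : Type*} [Field k] {n : ℕ} (Δ : MvPolynomial (Fin n × Fin 3) k) :
    ∃ (N : ℕ) (Δ' : MvPolynomial (Fin n × Fin 4) k), ∀ p : Fin n → Fin 4 → k,
      (∀ j, p j 0 ≠ 0) → eval (fun x => p x.1 x.2) Δ' =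
        (∏ j, p j 0) ^ N * eval (fun x : Fin n × Fin 3 => p x.1 x.2.succ / p x.1 0) Δ := by
  classical
  induction Δ using MvPolynomial.induction_on with
  | C a => exact ⟨0, C a, by simp⟩
  | add f g hf hg =>
    obtain ⟨N₁, f', hf⟩ := hf
    obtain ⟨N₂, g', hg⟩ := hg
    refine ⟨N₁ + N₂, (∏ j, X (j, 0)) ^ N₂ * f' + (∏ j, X (j, 0)) ^ N₁ * g', fun p hp => ?_⟩
    simp only [map_add, map_mul, map_pow, map_prod, eval_X, hf p hp, hg p hp]
    ring
  | mul_X f x hf =>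
    obtain ⟨N, f', hf⟩ := hf
    obtain ⟨j, i⟩ := x
    refine ⟨N + 1, f' * X (j, i.succ) * ∏ l ∈ Finset.univ.erase j, X (l, 0), fun p hp => ?_⟩
    simp only [map_mul, map_prod, eval_X, hf p hp]
    rw [pow_succ, ← Finset.mul_prod_erase Finset.univ (fun j => p j 0) (Finset.mem_univ j)]
    have := hp j
    field_simp

/-- The generic condition used in the proof. -/
theorem generic_of_cond (k : Type*) [Field k] [CharZero k] (n a : ℕ) (ha : a ^ 3 ≤ n)
    (ha' : n < (a + 1) ^ 3) (P : (Fin n → (Fin 4 → k)) → Prop)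
    (hP : ∀ p : Fin n → (Fin 4 → k), (∀ j, p j 0 ≠ 0) →
      JetCond (fun j (i : Fin 3) => p j i.succ / p j 0) 40 (a * 37) →
      (∃ B : Fin n → expLT 3 (2 * a + 1) → k, ∀ i j,
          ∑ γ, B i γ * ∏ l : Fin 3, (p j l.succ / p j 0) ^ (γ.1 l) = if i = j then 1 else 0) → P p) :
    Generic k 3 n P := by
  classical
  obtain ⟨q₀, hq₀⟩ := exists_grid k a n ha
  obtain ⟨Δ₁, hΔ₁, H₁⟩ := jet_open q₀ _ _ hq₀
  obtain ⟨Δ₂, hΔ₂, H₂⟩ := sep_open (k := k) n (2 * a) (by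
    rw [card_expLT_three]; exact lt_choose a n ha')
  obtain ⟨N, Δ', hΔ'⟩ := homogenize_open (Δ₁ * Δ₂)
  refine ⟨{(∏ j, X (j, 0)) * Δ'}, ?_, ?_⟩
  · obtain ⟨x, hx⟩ : ∃ x, eval x (Δ₁ * Δ₂) ≠ 0 := by
      by_contra hcon
      push Not at hcon
      exact mul_ne_zero hΔ₁ hΔ₂ (MvPolynomial.funext fun x => by rw [hcon, map_zero])
    refine ⟨fun j => Fin.cons 1 (fun i => x (j, i)), ?_, _, rfl, ?_⟩
    · intro j hj
      have := congrFun hj 0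
      simp at this
    · rw [map_mul, hΔ' (fun j => Fin.cons 1 (fun i => x (j, i))) (by simp)]
      simpa using hx
  · rintro p - ⟨f, hf, hfp⟩
    rw [Set.mem_singleton_iff] at hf
    subst hf
    rw [map_mul, map_prod] at hfp
    have hp : ∀ j, p j 0 ≠ 0 := by
      intro j
      have := Finset.prod_ne_zero_iff.mp (left_ne_zero_of_mul hfp) j (Finset.mem_univ j)
      simpa using this
    have h2 := right_ne_zero_of_mul hfp
    rw [hΔ' p hp] at h2
    have h3 := right_ne_zero_of_mul h2
    rw [map_mul] at h3
    exact hP p hp (H₁ _ (left_ne_zero_of_mul h3)) (H₂ _ (right_ne_zero_of_mul h3))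

/-! ### The lower bound on degrees -/

theorem eval_smul_hom {k σ : Type*} [Field k] {f : MvPolynomial σ k} {d : ℕ}
    (hf : f.IsHomogeneous d) (c : k) (x : σ → k) :
    eval (fun i => c * x i) f = c ^ d * eval x f := by
  rw [eval_eq, eval_eq, Finset.mul_sum]
  refine Finset.sum_congr rfl fun e he => ?_
  have h1 : e.degree = d := by
    by_contra hne
    exact (mem_support_iff.mp he) (hf.coeff_eq_zero hne)
  simp_rw [mul_pow]
  rw [Finset.prod_mul_distrib, Finset.prod_pow_eq_pow_sum, ← h1, Finsupp.degree_apply]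
  ring

theorem eval_of_mem_pointIdeal {k σ : Type*} [Field k] {p : σ → k} {f : MvPolynomial σ k}
    (hf : f ∈ pointIdeal p) : eval p f = 0 := by
  have : pointIdeal p ≤ RingHom.ker (eval p) := by
    rw [pointIdeal, Ideal.span_le]
    rintro g ⟨_, hg⟩
    exact hg
  exact this hf

theorem mem_affIdeal_iff {R σ : Type*} [CommRing R] (q : σ → R) (f : MvPolynomial σ R) :
    f ∈ affIdeal q ↔ eval q f = 0 := by
  have h1 := mem_affIdeal_pow_iff q 1 f
  rw [pow_one] at h1
  have h2 : coeff 0 (shiftHom q f) = eval q f := by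
    induction f using MvPolynomial.induction_on with
    | C a => simp [shiftHom]
    | add f g hf hg =>
      rw [map_add, coeff_add, map_add, hf, hg]
      · exact mem_affIdeal_pow_iff q 1 g |>.trans (by rfl) |> fun h => by rwa [pow_one] at h
      · exact mem_affIdeal_pow_iff q 1 f |>.trans (by rfl) |> fun h => by rwa [pow_one] at h
    | mul_X f i hf =>
      have := hf (mem_affIdeal_pow_iff q 1 f |>.trans (by rfl) |> fun h => by rwa [pow_one] at h)
      rw [← constantCoeff_eq] at this ⊢
      simp [this]
      simp [shiftHom]
  rw [h1, ← h2]
  constructor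
  · intro h; exact h 0 (by simp)
  · intro h β hβ
    have : β = 0 := by
      rw [Nat.lt_one_iff, Finsupp.degree_eq_zero_iff] at hβ
      exact hβ
    rw [this, h]

/-- Dehomogenisation. -/
noncomputable def dehom (k : Type*) [Field k] : MvPolynomial (Fin 4) k →ₐ[k] MvPolynomial (Fin 3) k :=
  aeval (Fin.cons 1 X : Fin 4 → MvPolynomial (Fin 3) k)

theorem eval_dehom {k : Type*} [Field k] (q : Fin 3 → k) (f : MvPolynomial (Fin 4) k) :
    eval q (dehom k f) = eval (Fin.cons 1 q : Fin 4 → k) f := by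
  induction f using MvPolynomial.induction_on with
  | C a => simp [dehom]
  | add f g hf hg => simp [hf, hg]
  | mul_X f i hf =>
    rw [map_mul, map_mul, map_mul, hf]
    congr 1
    refine Fin.cases ?_ (fun i => ?_) i <;> simp [dehom]

theorem totalDegree_dehom {k : Type*} [Field k] (f : MvPolynomial (Fin 4) k) :
    (dehom k f).totalDegree ≤ f.totalDegree := by
  rw [dehom, aeval_def, eval₂_eq']
  refine totalDegree_finsetSum_le fun d hd => ?_
  refine (totalDegree_mul _ _).trans ?_
  rw [algebraMap_eq, totalDegree_C, zero_add]
  refine (totalDegree_finsetProd _ _).trans ?_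
  refine le_trans ?_ (le_totalDegree hd)
  rw [Finsupp.sum_fintype _ _ (fun i => rfl)]
  refine Finset.sum_le_sum fun i _ => ?_
  refine (totalDegree_pow _ _).trans ?_
  refine Fin.cases ?_ (fun i => ?_) i <;> simp

theorem dehom_ne_zero {k : Type*} [Field k] [Infinite k] {f : MvPolynomial (Fin 4) k} {t : ℕ}
    (hf : f.IsHomogeneous t) (h0 : f ≠ 0) : dehom k f ≠ 0 := by
  intro h
  have h1 : X 0 * f = 0 := by
    apply MvPolynomial.funext
    intro x
    rw [map_mul, eval_X, map_zero]
    by_cases hx : x 0 = 0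
    · rw [hx, zero_mul]
    · have h2 := eval_dehom (fun i => x i.succ / x 0) f
      rw [h, map_zero] at h2
      have h3 := eval_smul_hom hf (x 0) (Fin.cons 1 (fun i : Fin 3 => x i.succ / x 0) : Fin 4 → k)
      rw [← h2, mul_zero] at h3
      have h4 : (fun i => x 0 * (Fin.cons 1 (fun i : Fin 3 => x i.succ / x 0) : Fin 4 → k) i) = x := by
        ext i
        refine Fin.cases ?_ (fun i => ?_) i
        · simp
        · simp; field_simp
      rw [h4] at h3
      rw [h3, mul_zero]
  rcases mul_eq_zero.mp h1 with h2 | h2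
  · exact X_ne_zero 0 h2
  · exact h0 h2

theorem alpha_bound {k : Type*} [Field k] [Infinite k] {n : ℕ} (p : Fin n → Fin 4 → k)
    (hp : ∀ j, p j 0 ≠ 0) (m D : ℕ)
    (hJ : JetCond (fun j (i : Fin 3) => p j i.succ / p j 0) m D)
    (F : MvPolynomial (Fin 4) k) (t : ℕ) (hF : F.IsHomogeneous t) (hF0 : F ≠ 0) (M : ℕ)
    (hmem : ∀ j, F ∈ pointIdeal (p j) ^ M) : M * D ≤ t * (m + 3) := by
  have h1 := jet_bound _ m D hJ (dehom k F) (dehom_ne_zero hF hF0) M (by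
    intro j
    have h2 := Ideal.mem_map_of_mem (dehom k) (hmem j)
    rw [Ideal.map_pow] at h2
    refine Ideal.pow_right_mono ?_ M h2
    rw [pointIdeal, Ideal.map_span, Ideal.span_le]
    rintro _ ⟨g, ⟨⟨d, hd⟩, hg⟩, rfl⟩
    rw [SetLike.mem_coe, mem_affIdeal_iff]
    erw [eval_dehom]
    have h3 := eval_smul_hom hd (p j 0)⁻¹ (p j)
    rw [hg, mul_zero] at h3
    rw [← h3]
    congr 2
    ext i
    refine Fin.cases ?_ (fun i => ?_) i
    · simp [hp j]
    · simp; field_simp)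
  refine h1.trans (Nat.mul_le_mul_right _ ?_)
  exact (totalDegree_dehom F).trans hF.totalDegree_le

/-! ### Powers of an ideal with linear exchange relations -/

/-- Products of `r` lifts with a monomial, of total exponent `μ`. -/
def TT {S : Type*} [CommRing S] (σ : ℕ) (Y L : (Fin 3 →₀ ℕ) → S) : ℕ → (Fin 3 →₀ ℕ) → S → Prop
  | 0, μ, τ => τ = Y μ
  | r + 1, μ, τ => ∃ w ν τ', w + ν = μ ∧ w.degree = σ ∧ TT σ Y L r ν τ' ∧ τ = L w * τ'

section Exchange

variable {S : Type*} [CommRing S] {σ : ℕ} {Y L : (Fin 3 →₀ ℕ) → S}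

theorem TT_mem (J : Ideal S) (hL : ∀ w, w.degree = σ → L w ∈ J) :
    ∀ r μ τ, TT σ Y L r μ τ → τ ∈ J ^ r := by
  intro r
  induction r with
  | zero => intro μ τ _; simp
  | succ r ih =>
    rintro μ τ ⟨w, ν, τ', _, hw, hτ', rfl⟩
    rw [pow_succ']
    exact Ideal.mul_mem_mul (hL w hw) (ih _ _ hτ')

theorem TT_mem' (J M : Ideal S) (hL : ∀ w, w.degree = σ → L w ∈ J)
    (hY : ∀ w, 1 ≤ w.degree → Y w ∈ M) :
    ∀ r μ τ, r * σ + 1 ≤ μ.degree → TT σ Y L r μ τ → τ ∈ M * J ^ r := by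
  intro r
  induction r with
  | zero => intro μ τ hμ h; rw [pow_zero, Ideal.one_eq_top, Ideal.mul_top, h]; exact hY _ (by omega)
  | succ r ih =>
    rintro μ τ hμ ⟨w, ν, τ', rfl, hw, hτ', rfl⟩
    rw [map_add] at hμ
    rw [pow_succ', mul_left_comm]
    exact Ideal.mul_mem_mul (hL w hw) (ih _ _ (by rw [add_mul] at hμ; omega) hτ')

theorem TT_mul (hYadd : ∀ w v, Y (w + v) = Y w * Y v) (v : Fin 3 →₀ ℕ) :
    ∀ r μ τ, TT σ Y L r μ τ → TT σ Y L r (v + μ) (Y v * τ) := by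
  intro r
  induction r with
  | zero => intro μ τ h; simp only [TT] at h ⊢; rw [h, hYadd]
  | succ r ih =>
    rintro μ τ ⟨w, ν, τ', rfl, hw, hτ', rfl⟩
    exact ⟨w, v + ν, Y v * τ', by abel, hw, ih _ _ hτ', by ring⟩

theorem exists_degree_eq (w : Fin 3 →₀ ℕ) (d : ℕ) (h : d ≤ w.degree) :
    ∃ v u, v + u = w ∧ v.degree = d := by
  induction d with
  | zero => exact ⟨0, w, by simp, by simp⟩
  | succ d ih =>
    obtain ⟨v, u, rfl, hv⟩ := ih (by omega)
    have hu : u ≠ 0 := by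
      rintro rfl
      simp at h
      omega
    obtain ⟨i, hi⟩ := Finsupp.ne_iff.mp hu
    refine ⟨v + Finsupp.single i 1, u - Finsupp.single i 1, ?_, by simp [hv]⟩
    rw [add_assoc, add_tsub_cancel_of_le]
    rw [Finsupp.single_le_iff]
    simp at hi
    omega

theorem TT_nonempty : ∀ r (μ : Fin 3 →₀ ℕ), r * σ ≤ μ.degree → ∃ τ, TT σ Y L r μ τ := by
  intro r
  induction r with
  | zero => intro μ _; exact ⟨Y μ, rfl⟩
  | succ r ih =>
    intro μ hμ
    rw [add_mul, one_mul] at hμ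
    obtain ⟨v, u, rfl, hv⟩ := exists_degree_eq μ σ (by omega)
    rw [map_add] at hμ
    obtain ⟨τ, hτ⟩ := ih u (by omega)
    exact ⟨_, v, u, τ, rfl, hv, hτ, rfl⟩

theorem TT_equiv (x : S) (J : Ideal S) (hL : ∀ w, w.degree = σ → L w ∈ J)
    (hYadd : ∀ w v, Y (w + v) = Y w * Y v)
    (hex : ∀ v i j, v.degree + 1 = σ →
      Y (Finsupp.single j 1) * L (v + Finsupp.single i 1) -
        Y (Finsupp.single i 1) * L (v + Finsupp.single j 1) ∈ Ideal.span {x} * J) :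
    ∀ r μ, r * σ + 1 ≤ μ.degree → ∀ τ τ', TT σ Y L r μ τ → TT σ Y L r μ τ' →
      τ - τ' ∈ Ideal.span {x} * J ^ r := by
  intro r
  induction r with
  | zero => intro μ _ τ τ' h h'; rw [h, h', sub_self]; exact Ideal.zero_mem _
  | succ r ih =>
    intro μ hμ τ τ' h ⟨w', ν', τ₁', hw'ν', hw', hτ₁', hτ'⟩
    subst hτ'
    have hdegν : ∀ w ν : Fin 3 →₀ ℕ, w + ν = μ → w.degree = σ → r * σ + 1 ≤ ν.degree := by
      rintro w ν rfl hw
      rw [map_add, hw, add_mul] at hμ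
      omega
    have key : ∀ N w ν τ₁, ∑ i, (w i - w' i) ≤ N → w + ν = μ → w.degree = σ →
        TT σ Y L r ν τ₁ → L w * τ₁ - L w' * τ₁' ∈ Ideal.span {x} * J ^ (r + 1) := by
      intro N
      induction N with
      | zero =>
        intro w ν τ₁ hs hwν hw hτ₁
        have hle : w ≤ w' := by
          intro i
          have := Finset.single_le_sum (f := fun i => w i - w' i) (fun _ _ => Nat.zero_le _)
            (Finset.mem_univ i)
          omega
        have hww : w = w' := by
          have h1 : w + (w' - w) = w' := add_tsub_cancel_of_le hle
          have h2 : (w' - w).degree = 0 := by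
            have := congrArg Finsupp.degree h1
            rw [map_add] at this
            omega
          rw [Finsupp.degree_eq_zero_iff] at h2
          rw [← h1, h2, add_zero]
        subst hww
        have hνν : ν = ν' := add_left_cancel (hwν.trans hw'ν'.symm)
        subst hνν
        rw [← mul_sub, pow_succ', mul_left_comm]
        exact Ideal.mul_mem_mul (hL w hw) (ih ν (hdegν w ν hwν hw) _ _ hτ₁ hτ₁')
      | succ N ihN =>
        intro w ν τ₁ hs hwν hw hτ₁
        by_cases hle : w ≤ w'
        · refine ihN w ν τ₁ ?_ hwν hw hτ₁
          rw [Finset.sum_eq_zero]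
          · omega
          · intro i _
            have := hle i
            omega
        by_cases hle' : w' ≤ w
        · exfalso
          apply hle
          have h1 : w' + (w - w') = w := add_tsub_cancel_of_le hle'
          have h2 : (w - w').degree = 0 := by
            have := congrArg Finsupp.degree h1
            rw [map_add] at this
            omega
          rw [Finsupp.degree_eq_zero_iff] at h2
          rw [← h1, h2, add_zero]
        rw [Finsupp.le_def] at hle hle'
        push Not at hle hle'
        obtain ⟨i, hi⟩ := hle
        obtain ⟨j, hj⟩ := hle'
        have hij : i ≠ j := by rintro rfl; omega
        obtain ⟨v, rfl⟩ : ∃ v, w = v + Finsupp.single i 1 :=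
          ⟨w - Finsupp.single i 1, (tsub_add_cancel_of_le (by
            rw [Finsupp.single_le_iff]; omega)).symm⟩
        have hνj : 1 ≤ ν j := by
          have h1 := DFunLike.congr_fun hwν j
          have h2 := DFunLike.congr_fun hw'ν' j
          simp only [Finsupp.add_apply] at h1 h2 hj
          omega
        obtain ⟨ρ, rfl⟩ : ∃ ρ, ν = Finsupp.single j 1 + ρ :=
          ⟨ν - Finsupp.single j 1, (add_tsub_cancel_of_le (by
            rw [Finsupp.single_le_iff]; omega)).symm⟩
        have hdν := hdegν _ _ hwν hw
        obtain ⟨τ₂, hτ₂⟩ := TT_nonempty (σ := σ) (Y := Y) (L := L) r ρ (by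
          rw [map_add, Finsupp.degree_single] at hdν; omega)
        have hv : v.degree + 1 = σ := by rw [map_add, Finsupp.degree_single] at hw; exact hw
        have e1 := ih _ hdν _ _ hτ₁ (TT_mul hYadd (Finsupp.single j 1) r ρ τ₂ hτ₂)
        have e2 := ihN (v + Finsupp.single j 1) (Finsupp.single i 1 + ρ)
          (Y (Finsupp.single i 1) * τ₂) (by
            have : ∑ l, ((v + Finsupp.single j 1 : Fin 3 →₀ ℕ) l - w' l) <
                ∑ l, ((v + Finsupp.single i 1 : Fin 3 →₀ ℕ) l - w' l) := by
              refine Finset.sum_lt_sum ?_ ⟨i, Finset.mem_univ i, ?_⟩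
              · intro l _
                simp only [Finsupp.add_apply] at hi hj ⊢
                by_cases hlj : l = j
                · subst hlj
                  simp only [Finsupp.single_eq_same] at *
                  simp only [Finsupp.single_eq_of_ne hij.symm] at *
                  omega
                · rw [Finsupp.single_eq_of_ne hlj]
                  omega
              · simp only [Finsupp.add_apply] at hi ⊢
                rw [Finsupp.single_eq_same] at hi ⊢
                rw [Finsupp.single_eq_of_ne hij]
                omega
            omega) (by rw [← hwν]; abel) (by rw [map_add, Finsupp.degree_single]; exact hv)
            (TT_mul hYadd (Finsupp.single i 1) r ρ τ₂ hτ₂)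
        have e3 := Ideal.mul_mem_mul (hex v i j hv) (TT_mem J hL r ρ τ₂ hτ₂)
        rw [mul_assoc, ← pow_succ'] at e3
        have e1' := Ideal.mul_mem_mul (hL _ hw) e1
        rw [mul_left_comm, ← pow_succ'] at e1'
        have := Ideal.add_mem _ (Ideal.add_mem _ e1' e3) e2
        convert this using 1
        ring
    obtain ⟨w, ν, τ₁, hwν, hw, hτ₁, rfl⟩ := h
    exact key _ w ν τ₁ le_rfl hwν hw hτ₁

end Exchange

/-! ### Division by the variable `x₀` -/

/-- Monomials in the last three variables. -/
noncomputable def Yc (k : Type*) [Field k] (w : Fin 3 →₀ ℕ) : MvPolynomial (Fin 4) k :=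
  rename Fin.succ (monomial w (1 : k))

/-- Setting the first variable to zero. -/
noncomputable def piz (k : Type*) [Field k] : MvPolynomial (Fin 4) k →ₐ[k] MvPolynomial (Fin 3) k :=
  aeval (Fin.cons 0 X : Fin 4 → MvPolynomial (Fin 3) k)

theorem Yc_add {k : Type*} [Field k] (w v : Fin 3 →₀ ℕ) : Yc k (w + v) = Yc k w * Yc k v := by
  rw [Yc, Yc, Yc, ← map_mul, monomial_mul, one_mul]

theorem piz_Yc {k : Type*} [Field k] (w : Fin 3 →₀ ℕ) : piz k (Yc k w) = monomial w 1 := by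
  rw [piz, Yc, aeval_rename]
  have : (Fin.cons 0 X : Fin 4 → MvPolynomial (Fin 3) k) ∘ Fin.succ = X := by
    ext1 i; simp
  rw [this, aeval_X_left_apply]

theorem piz_X_zero {k : Type*} [Field k] : piz k (X 0) = 0 := by simp [piz]

theorem Yc_isHomogeneous {k : Type*} [Field k] (w : Fin 3 →₀ ℕ) :
    (Yc k w).IsHomogeneous w.degree :=
  (isHomogeneous_monomial 1 rfl).rename_isHomogeneous

theorem monomial_cases {k : Type*} [Field k] (u : Fin 4 →₀ ℕ) (c : k) :
    (∃ w : Fin 3 →₀ ℕ, w.degree = u.degree ∧ monomial u c = c • Yc k w) ∨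
      ∃ u' : Fin 4 →₀ ℕ, u'.degree + 1 = u.degree ∧ monomial u c = X 0 * monomial u' c := by
  by_cases h : u 0 = 0
  · left
    have h1 : Finsupp.mapDomain Fin.succ (Finsupp.tail u) = u := by
      ext i
      refine Fin.cases ?_ (fun i => ?_) i
      · rw [Finsupp.mapDomain_of_notMem_range, h]
        rintro ⟨i, hi⟩
        exact Fin.succ_ne_zero i hi
      · rw [Finsupp.mapDomain_apply (Fin.succ_injective 3)]
        rfl
    refine ⟨Finsupp.tail u, ?_, ?_⟩
    · conv_rhs => rw [← h1]
      rw [Finsupp.degree_mapDomain]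
    · rw [Yc, rename_monomial, h1, smul_monomial, smul_eq_mul, mul_one]
  · right
    have h1 : Finsupp.single 0 1 + (u - Finsupp.single 0 1) = u :=
      add_tsub_cancel_of_le (by rw [Finsupp.single_le_iff]; omega)
    refine ⟨u - Finsupp.single 0 1, ?_, ?_⟩
    · conv_rhs => rw [← h1]
      rw [map_add, Finsupp.degree_single, add_comm]
    · conv_lhs => rw [← h1]
      rw [X, monomial_mul, one_mul]

theorem piz_TT {k : Type*} [Field k] {σ : ℕ} {L : (Fin 3 →₀ ℕ) → MvPolynomial (Fin 4) k}
    (hπL : ∀ w, w.degree = σ → piz k (L w) = monomial w 1) :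
    ∀ r μ τ, TT σ (Yc k) L r μ τ → piz k τ = monomial μ 1 := by
  intro r
  induction r with
  | zero => intro μ τ h; rw [h, piz_Yc]
  | succ r ih =>
    rintro μ τ ⟨w, ν, τ', rfl, hw, hτ', rfl⟩
    rw [map_mul, hπL w hw, ih _ _ hτ', monomial_mul, one_mul]

theorem Yc_mem {k : Type*} [Field k] (w : Fin 3 →₀ ℕ) (hw : 1 ≤ w.degree) :
    Yc k w ∈ maxIdeal k 3 := by
  have : w ≠ 0 := by rintro rfl; simp at hw
  obtain ⟨i, hi⟩ := Finsupp.ne_iff.mp this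
  have h1 : Finsupp.single i 1 + (w - Finsupp.single i 1) = w :=
    add_tsub_cancel_of_le (by rw [Finsupp.single_le_iff]; simp at hi; omega)
  rw [← h1, Yc_add]
  refine Ideal.mul_mem_right _ _ (Ideal.subset_span ⟨i.succ, ?_⟩)
  rw [Yc, ← X, rename_X]

theorem mul_max_pow_le {k : Type*} [Field k] {σ : ℕ} {L : (Fin 3 →₀ ℕ) → MvPolynomial (Fin 4) k}
    (Gen : Set (MvPolynomial (Fin 4) k))
    (hL : ∀ w, w.degree = σ → L w ∈ Ideal.span Gen)
    (hgen : ∀ f ∈ Gen, ∃ P ∈ Submodule.span k {g | ∃ w, w.degree = σ ∧ g = L w}, ∃ h,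
      f = P + X 0 * h ∧ ∀ m ∈ maxIdeal k 3, h * m ∈ Ideal.span Gen) :
    ∀ r, ∀ G ∈ maxIdeal k 3 * Ideal.span Gen ^ r,
      G ∈ Submodule.span k {τ | ∃ μ, r * σ + 1 ≤ μ.degree ∧ TT σ (Yc k) L r μ τ} ⊔
        (Ideal.span {X 0} * Ideal.span Gen ^ r).restrictScalars k := by
  intro r
  induction r with
  | zero =>
    intro G hG
    rw [pow_zero, Ideal.one_eq_top, Ideal.mul_top] at hG ⊢
    have h0 : ∀ u, u.degree < 1 → coeff u G = 0 := by
      have : G ∈ idealOfVars (Fin 4) k ^ 1 := by rw [pow_one]; exact hG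
      rwa [mem_pow_idealOfVars_iff'] at this
    rw [G.as_sum]
    refine Submodule.sum_mem _ fun u hu => ?_
    rcases monomial_cases u (coeff u G) with ⟨w, hw, hwe⟩ | ⟨u', _, hue⟩
    · rw [hwe]
      refine Submodule.mem_sup_left (Submodule.smul_mem _ _ (Submodule.subset_span ⟨w, ?_, rfl⟩))
      by_contra hlt
      exact mem_support_iff.mp hu (h0 u (by omega))
    · rw [hue]
      refine Submodule.mem_sup_right ?_
      exact Ideal.mul_mem_right _ _ (Ideal.mem_span_singleton_self _)
  | succ r ih =>
    intro G hG
    rw [pow_succ', mul_left_comm] at hG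
    set W := Submodule.span k {τ | ∃ μ, (r + 1) * σ + 1 ≤ μ.degree ∧ TT σ (Yc k) L (r + 1) μ τ} ⊔
        (Ideal.span {X 0} * Ideal.span Gen ^ (r + 1)).restrictScalars k with hW
    -- products of a generator and an element
    have main : ∀ f ∈ Gen, ∀ g ∈ maxIdeal k 3 * Ideal.span Gen ^ r, f * g ∈ W := by
      intro f hf g hg
      have hg' := ih g hg
      obtain ⟨g₁, hg₁, g₂, hg₂, rfl⟩ := Submodule.mem_sup.mp hg'
      rw [mul_add]
      refine Submodule.add_mem _ ?_ ?_
      · clear hg hg' hg₂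
        induction hg₁ using Submodule.span_induction with
        | mem τ hτ =>
          obtain ⟨μ, hμ, hτ⟩ := hτ
          obtain ⟨P, hP, h, rfl, hh⟩ := hgen f hf
          rw [add_mul]
          refine Submodule.add_mem _ ?_ ?_
          · refine Submodule.mem_sup_left ?_
            clear hf hh
            induction hP using Submodule.span_induction with
            | mem q hq =>
              obtain ⟨w, hw, rfl⟩ := hq
              refine Submodule.subset_span ⟨w + μ, ?_, w, μ, τ, rfl, hw, hτ, rfl⟩
              rw [map_add, add_mul]; omega
            | zero => rw [zero_mul]; exact Submodule.zero_mem _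
            | add a b _ _ ha hb => rw [add_mul a b τ]; exact Submodule.add_mem _ ha hb
            | smul c a _ ha => rw [smul_mul_assoc]; exact Submodule.smul_mem _ _ ha
          · refine Submodule.mem_sup_right ?_
            rw [mul_assoc]
            refine Ideal.mul_mem_mul (Ideal.mem_span_singleton_self _) ?_
            have h1 := TT_mem' _ (maxIdeal k 3) hL Yc_mem r μ τ hμ hτ
            rw [pow_succ']
            have h2 : Ideal.span {h} * (maxIdeal k 3 * Ideal.span Gen ^ r) ≤
                Ideal.span Gen * Ideal.span Gen ^ r := by
              rw [← mul_assoc]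
              refine Ideal.mul_mono_left ?_
              rw [Ideal.span_singleton_mul_le_iff]
              exact hh
            exact h2 (Ideal.mul_mem_mul (Ideal.mem_span_singleton_self _) h1)
        | zero => rw [mul_zero]; exact Submodule.zero_mem _
        | add a b _ _ ha hb => rw [mul_add]; exact Submodule.add_mem _ ha hb
        | smul c a _ ha => rw [mul_smul_comm]; exact Submodule.smul_mem _ _ ha
      · refine Submodule.mem_sup_right ?_
        change f * g₂ ∈ Ideal.span {X 0} * Ideal.span Gen ^ (r + 1)
        rw [pow_succ', mul_left_comm]
        exact Ideal.mul_mem_mul (Ideal.subset_span hf) hg₂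
    induction hG using Submodule.mul_induction_on' with
    | mem_mul_mem f hf g hg =>
      have : ∀ g ∈ maxIdeal k 3 * Ideal.span Gen ^ r, f * g ∈ W := by
        clear hg g
        induction hf using Submodule.span_induction with
        | mem f hf => exact main f hf
        | zero => intro g _; rw [zero_mul]; exact Submodule.zero_mem _
        | add a b _ _ ha hb => 
          intro g hg; rw [add_mul]; exact Submodule.add_mem _ (ha g hg) (hb g hg)
        | smul c a _ ha =>
          intro g hg
          rw [smul_eq_mul, mul_assoc, mul_left_comm]
          exact ha _ (Ideal.mul_mem_left _ _ hg)
      exact this g hg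
    | add a _ b _ ha hb => exact Submodule.add_mem _ ha hb

theorem colon_x {k : Type*} [Field k] {σ : ℕ} {L : (Fin 3 →₀ ℕ) → MvPolynomial (Fin 4) k}
    (Gen : Set (MvPolynomial (Fin 4) k))
    (hL : ∀ w, w.degree = σ → L w ∈ Ideal.span Gen)
    (hπL : ∀ w, w.degree = σ → piz k (L w) = monomial w 1)
    (hex : ∀ v i j, v.degree + 1 = σ →
      Yc k (Finsupp.single j 1) * L (v + Finsupp.single i 1) -
        Yc k (Finsupp.single i 1) * L (v + Finsupp.single j 1) ∈ Ideal.span {X 0} * Ideal.span Gen)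
    (hgen : ∀ f ∈ Gen, ∃ P ∈ Submodule.span k {g | ∃ w, w.degree = σ ∧ g = L w}, ∃ h,
      f = P + X 0 * h ∧ ∀ m ∈ maxIdeal k 3, h * m ∈ Ideal.span Gen)
    (r : ℕ) (F : MvPolynomial (Fin 4) k) (hF : X 0 * F ∈ maxIdeal k 3 * Ideal.span Gen ^ r) :
    F ∈ Ideal.span Gen ^ r := by
  classical
  have h1 := mul_max_pow_le Gen hL hgen r _ hF
  choose τ hτ using fun μ : {μ : Fin 3 →₀ ℕ // r * σ ≤ μ.degree} =>
    TT_nonempty (σ := σ) (Y := Yc k) (L := L) r μ.1 μ.2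
  let Φ : MvPolynomial (Fin 3) k →ₗ[k] MvPolynomial (Fin 4) k :=
    (basisMonomials (Fin 3) k).constr k (fun μ => if h : r * σ ≤ μ.degree then τ ⟨μ, h⟩ else 0)
  have hΦ : ∀ μ (h : r * σ ≤ μ.degree), Φ (monomial μ 1) = τ ⟨μ, h⟩ := by
    intro μ h
    have := (basisMonomials (Fin 3) k).constr_basis k
      (fun μ => if h : r * σ ≤ μ.degree then τ ⟨μ, h⟩ else 0) μ
    rw [coe_basisMonomials] at this
    simp only [Φ]
    rw [this, dif_pos h]
  have h2 : ∀ G ∈ Submodule.span k {τ | ∃ μ, r * σ + 1 ≤ μ.degree ∧ TT σ (Yc k) L r μ τ} ⊔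
        (Ideal.span {X 0} * Ideal.span Gen ^ r).restrictScalars k,
      G - Φ (piz k G) ∈ Ideal.span {X 0} * Ideal.span Gen ^ r := by
    intro G hG
    obtain ⟨g₁, hg₁, g₂, hg₂, rfl⟩ := Submodule.mem_sup.mp hG
    replace hg₂ : g₂ ∈ Ideal.span {X 0} * Ideal.span Gen ^ r := hg₂
    have e1 : g₁ - Φ (piz k g₁) ∈ Ideal.span {X 0} * Ideal.span Gen ^ r := by
      clear hG hg₂
      induction hg₁ using Submodule.span_induction with
      | mem t ht =>
        obtain ⟨μ, hμ, ht⟩ := ht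
        rw [piz_TT hπL r μ t ht, hΦ μ (by omega)]
        exact TT_equiv _ _ hL Yc_add hex r μ hμ _ _ ht (hτ ⟨μ, by omega⟩)
      | zero => simp
      | add a b _ _ ha hb =>
        have := Ideal.add_mem _ ha hb
        convert this using 1
        simp only [map_add]; ring
      | smul c a _ ha =>
        have := Ideal.mul_mem_left _ (C c) ha
        rwa [map_smul, map_smul, ← smul_sub, smul_eq_C_mul]
    have e2 : piz k g₂ = 0 := by
      obtain ⟨u, _, rfl⟩ := Ideal.mem_span_singleton_mul.mp hg₂
      rw [map_mul, piz_X_zero, zero_mul]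
    rw [map_add, e2, add_zero, add_sub_right_comm]
    exact Ideal.add_mem _ e1 hg₂
  have h3 := h2 _ h1
  rw [map_mul, piz_X_zero, zero_mul, map_zero, sub_zero, Ideal.mem_span_singleton_mul] at h3
  obtain ⟨z, hz, hze⟩ := h3
  exact mul_left_cancel₀ (X_ne_zero 0) hze ▸ hz

/-! ### Ideals generated in one degree -/

/-- The ideal is generated by forms of degree `d`. -/
def GenDeg {k τ : Type*} [Field k] (K : Ideal (MvPolynomial τ k)) (d : ℕ) : Prop :=
  ∃ A : Set (MvPolynomial τ k), K = Ideal.span A ∧ ∀ a ∈ A, a.IsHomogeneous d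

open scoped Pointwise in
theorem GenDeg.mul {k τ : Type*} [Field k] {K K' : Ideal (MvPolynomial τ k)} {d d' : ℕ}
    (h : GenDeg K d) (h' : GenDeg K' d') : GenDeg (K * K') (d + d') := by
  obtain ⟨A, rfl, hA⟩ := h
  obtain ⟨A', rfl, hA'⟩ := h'
  refine ⟨A * A', Ideal.span_mul_span' A A', ?_⟩
  rintro _ ⟨a, ha, b, hb, rfl⟩
  exact (hA a ha).mul (hA' b hb)

theorem GenDeg.pow {k τ : Type*} [Field k] {K : Ideal (MvPolynomial τ k)} {d : ℕ}
    (h : GenDeg K d) (r : ℕ) : GenDeg (K ^ r) (r * d) := by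
  induction r with
  | zero =>
    refine ⟨{1}, by simp, ?_⟩
    rintro _ rfl
    rw [zero_mul]
    exact isHomogeneous_one _ _
  | succ r ih =>
    rw [pow_succ, add_mul, one_mul]
    exact ih.mul h

theorem monomial_mem_max_pow {k : Type*} [Field k] (u : Fin 4 →₀ ℕ) (c : k) (e : ℕ)
    (h : e ≤ u.degree) : monomial u c ∈ maxIdeal k 3 ^ e := by
  classical
  change _ ∈ idealOfVars (Fin 4) k ^ e
  rw [mem_pow_idealOfVars_iff']
  intro β hβ
  rw [coeff_monomial, if_neg]
  rintro rfl
  omega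

theorem GenDeg.mem {k : Type*} [Field k] {K : Ideal (MvPolynomial (Fin 4) k)} {d e t : ℕ}
    (h : GenDeg K d) {F : MvPolynomial (Fin 4) k} (hF : F ∈ K) (hFh : F.IsHomogeneous t)
    (ht : d + e ≤ t) : F ∈ maxIdeal k 3 ^ e * K := by
  classical
  obtain ⟨A, rfl, hA⟩ := h
  have key : ∀ F ∈ Ideal.span A, ∀ h : MvPolynomial (Fin 4) k,
      homogeneousComponent t (h * F) ∈ maxIdeal k 3 ^ e * Ideal.span A := by
    intro F hF
    induction hF using Submodule.span_induction with
    | mem a ha =>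
      intro h
      induction h using MvPolynomial.induction_on' with
      | monomial u c =>
        have hh : (monomial u c * a).IsHomogeneous (u.degree + d) :=
          (isHomogeneous_monomial c rfl).mul (hA a ha)
        rw [homogeneousComponent_of_mem hh]
        split_ifs with hu
        · exact Ideal.mul_mem_mul (monomial_mem_max_pow u c e (by omega)) (Ideal.subset_span ha)
        · exact Ideal.zero_mem _
      | add f g hf hg => rw [add_mul, map_add]; exact Ideal.add_mem _ hf hg
    | zero => intro h; rw [mul_zero, map_zero]; exact Ideal.zero_mem _
    | add a b _ _ ha hb => intro h; rw [mul_add, map_add]; exact Ideal.add_mem _ (ha h) (hb h)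
    | smul c a _ ha => intro h; rw [smul_eq_mul, ← mul_assoc]; exact ha _
  have := key F hF 1
  rwa [one_mul, homogeneousComponent_eq_self hFh] at this

/-! ### The containment -/

/-- Forms of degree `d` vanishing at all the points. -/
def vanDeg {k : Type*} [Field k] {n : ℕ} (p : Fin n → Fin 4 → k) (d : ℕ) :
    Set (MvPolynomial (Fin 4) k) :=
  {f | f.IsHomogeneous d ∧ ∀ j, eval (p j) f = 0}

section Containment

variable {k : Type*} [Field k] {n : ℕ} {p : Fin n → Fin 4 → k} {s : ℕ}
  {e : Fin n → MvPolynomial (Fin 4) k}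

theorem eval_of_mem_span_vanDeg {d : ℕ} {f : MvPolynomial (Fin 4) k}
    (hf : f ∈ Ideal.span (vanDeg p d)) (j : Fin n) : eval (p j) f = 0 := by
  have : Ideal.span (vanDeg p d) ≤ RingHom.ker (eval (p j)) := by
    rw [Ideal.span_le]
    rintro g ⟨_, hg⟩
    exact hg j
  exact this hf

/-- The correction term of the lift. -/
noncomputable def gcor (p : Fin n → Fin 4 → k) (e : Fin n → MvPolynomial (Fin 4) k)
    (w : Fin 3 →₀ ℕ) : MvPolynomial (Fin 4) k :=
  ∑ j, (eval (p j) (Yc k w) / p j 0) • e j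

/-- The lift of the monomial `Y w` to a form vanishing at the points. -/
noncomputable def Lc (p : Fin n → Fin 4 → k) (e : Fin n → MvPolynomial (Fin 4) k)
    (w : Fin 3 →₀ ℕ) : MvPolynomial (Fin 4) k :=
  Yc k w - X 0 * gcor p e w

theorem gcor_hom (heh : ∀ j, (e j).IsHomogeneous s) (w : Fin 3 →₀ ℕ) :
    (gcor p e w).IsHomogeneous s := by
  refine IsHomogeneous.sum _ _ _ fun j _ => ?_
  rw [smul_eq_C_mul]
  exact (heh j).C_mul _

theorem Lc_mem (hp : ∀ j, p j 0 ≠ 0) (heh : ∀ j, (e j).IsHomogeneous s)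
    (hee : ∀ i j, eval (p j) (e i) = if i = j then 1 else 0) (w : Fin 3 →₀ ℕ)
    (hw : w.degree = s + 1) : Lc p e w ∈ vanDeg p (s + 1) := by
  refine ⟨?_, fun j => ?_⟩
  · refine IsHomogeneous.sub (hw ▸ Yc_isHomogeneous w) ?_
    rw [add_comm]
    exact (isHomogeneous_X k 0).mul (gcor_hom heh w)
  · have := hp j
    rw [Lc, gcor, map_sub, map_mul, map_sum, eval_X]
    simp only [smul_eval, hee, mul_ite, mul_one, mul_zero, Finset.sum_ite_eq', Finset.mem_univ, if_true]
    field_simp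
    ring

theorem van_of_mul (hp : ∀ j, p j 0 ≠ 0) {h : MvPolynomial (Fin 4) k}
    (hh : ∀ j, eval (p j) (X 0 * h) = 0) (j : Fin n) : eval (p j) h = 0 := by
  have := hh j
  rw [map_mul, eval_X] at this
  exact (mul_eq_zero.mp this).resolve_left (hp j)

theorem Yc_single (i : Fin 3) : Yc k (Finsupp.single i 1) = X i.succ := by
  rw [Yc, ← X, rename_X]

/-- Decomposition of forms of degree `s + 1`. -/
theorem decomp_hom (heh : ∀ j, (e j).IsHomogeneous s) {F : MvPolynomial (Fin 4) k}
    (hF : F.IsHomogeneous (s + 1)) :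
    ∃ P ∈ Submodule.span k {g | ∃ w : Fin 3 →₀ ℕ, w.degree = s + 1 ∧ g = Lc p e w}, ∃ h,
      h.IsHomogeneous s ∧ F = P + X 0 * h := by
  have : F ∈ Submodule.span k {g | ∃ w : Fin 3 →₀ ℕ, w.degree = s + 1 ∧ g = Lc p e w} ⊔
      (homogeneousSubmodule (Fin 4) k s).map (LinearMap.mulLeft k (X 0)) := by
    rw [F.as_sum]
    refine Submodule.sum_mem _ fun u hu => ?_
    have hud : u.degree = s + 1 := by
      by_contra hne
      exact mem_support_iff.mp hu (hF.coeff_eq_zero hne)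
    rcases monomial_cases u (coeff u F) with ⟨w, hw, hwe⟩ | ⟨u', hu', hue⟩
    · have : Yc k w = Lc p e w + X 0 * gcor p e w := by rw [Lc]; ring
      rw [hwe, this]
      refine Submodule.smul_mem _ _ (Submodule.add_mem_sup (Submodule.subset_span ⟨w, by omega, rfl⟩) ?_)
      exact ⟨_, gcor_hom heh w, rfl⟩
    · rw [hue]
      exact Submodule.mem_sup_right ⟨_, isHomogeneous_monomial _ (by omega), rfl⟩
  obtain ⟨P, hP, _, ⟨h, hh, rfl⟩, rfl⟩ := Submodule.mem_sup.mp this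
  exact ⟨P, hP, h, hh, rfl⟩

theorem span_Lc_le (hp : ∀ j, p j 0 ≠ 0) (heh : ∀ j, (e j).IsHomogeneous s)
    (hee : ∀ i j, eval (p j) (e i) = if i = j then 1 else 0) {P : MvPolynomial (Fin 4) k}
    (hP : P ∈ Submodule.span k {g | ∃ w : Fin 3 →₀ ℕ, w.degree = s + 1 ∧ g = Lc p e w}) :
    P ∈ Ideal.span (vanDeg p (s + 1)) := by
  have : Submodule.span k {g | ∃ w : Fin 3 →₀ ℕ, w.degree = s + 1 ∧ g = Lc p e w} ≤
      (Ideal.span (vanDeg p (s + 1))).restrictScalars k := by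
    rw [Submodule.span_le]
    rintro _ ⟨w, hw, rfl⟩
    exact Ideal.subset_span (Lc_mem hp heh hee w hw)
  exact this hP

theorem hom_decomp_high (hp : ∀ j, p j 0 ≠ 0) (heh : ∀ j, (e j).IsHomogeneous s)
    (hee : ∀ i j, eval (p j) (e i) = if i = j then 1 else 0) (d : ℕ) :
    ∀ F : MvPolynomial (Fin 4) k, F.IsHomogeneous (s + d) →
      ∃ P ∈ Ideal.span (vanDeg p (s + 1)), ∃ h : MvPolynomial (Fin 4) k, h.IsHomogeneous s ∧
        F = P + X 0 ^ d * h := by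
  intro F hF
  have : F ∈ (Ideal.span (vanDeg p (s + 1))).restrictScalars k ⊔
      (homogeneousSubmodule (Fin 4) k s).map (LinearMap.mulLeft k (X 0 ^ d)) := by
    induction d generalizing F with
    | zero =>
      refine Submodule.mem_sup_right ⟨F, hF, by simp⟩
    | succ d ih =>
      rw [F.as_sum]
      refine Submodule.sum_mem _ fun u hu => ?_
      have hud : u.degree = s + (d + 1) := by
        by_contra hne
        exact mem_support_iff.mp hu (hF.coeff_eq_zero hne)
      have hu0 : u ≠ 0 := by rintro rfl; simp at hud
      obtain ⟨i, hi⟩ := Finsupp.ne_iff.mp hu0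
      have h1 : Finsupp.single i 1 + (u - Finsupp.single i 1) = u :=
        add_tsub_cancel_of_le (by rw [Finsupp.single_le_iff]; simp at hi; omega)
      have h2 : (monomial u (coeff u F) : MvPolynomial (Fin 4) k) =
          X i * monomial (u - Finsupp.single i 1) (coeff u F) := by
        conv_lhs => rw [← h1]
        rw [X, monomial_mul, one_mul, h1]
      have h3 : (u - Finsupp.single i 1).degree = s + d := by
        have := congrArg Finsupp.degree h1
        rw [map_add, Finsupp.degree_single] at this
        omega
      obtain ⟨P, hP, _, ⟨h, hh, rfl⟩, hPh⟩ := Submodule.mem_sup.mp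
        (ih (monomial (u - Finsupp.single i 1) (coeff u F)) (isHomogeneous_monomial _ h3))
      obtain ⟨P', hP', h', hh', hPh'⟩ := decomp_hom (p := p) heh (F := X i * h) (by
        rw [add_comm]; exact (isHomogeneous_X k i).mul hh)
      rw [h2, ← hPh]
      refine Submodule.mem_sup.mpr ⟨X i * P + X 0 ^ d * P', ?_, X 0 ^ (d + 1) * h', ⟨h', hh', rfl⟩, ?_⟩
      · exact Ideal.add_mem _ (Ideal.mul_mem_left _ _ hP)
          (Ideal.mul_mem_left _ _ (span_Lc_le hp heh hee hP'))
      · simp only [LinearMap.mulLeft_apply]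
        calc _ = X i * P + X 0 ^ d * (P' + X 0 * h') := by ring
          _ = X i * P + X 0 ^ d * (X i * h) := by rw [hPh']
          _ = _ := by ring
  obtain ⟨P, hP, _, ⟨h, hh, rfl⟩, rfl⟩ := Submodule.mem_sup.mp this
  exact ⟨P, hP, h, hh, rfl⟩

/-- Forms of degree at least `s + 1` vanishing at the points. -/
theorem van_high (hp : ∀ j, p j 0 ≠ 0) (heh : ∀ j, (e j).IsHomogeneous s)
    (hee : ∀ i j, eval (p j) (e i) = if i = j then 1 else 0) (d : ℕ)
    {F : MvPolynomial (Fin 4) k} (hF : F.IsHomogeneous (s + 1 + d))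
    (hFv : ∀ j, eval (p j) F = 0) : F ∈ Ideal.span (vanDeg p (s + 1)) := by
  obtain ⟨P, hP, h, hh, rfl⟩ := hom_decomp_high hp heh hee (d + 1) F (by
    rwa [show s + (d + 1) = s + 1 + d by omega])
  refine Ideal.add_mem _ hP ?_
  have hv : ∀ j, eval (p j) h = 0 := by
    intro j
    have h1 := hFv j
    rw [map_add, eval_of_mem_span_vanDeg hP, zero_add, map_mul, map_pow, eval_X] at h1
    exact (mul_eq_zero.mp h1).resolve_left (pow_ne_zero _ (hp j))
  rw [pow_succ, mul_assoc]
  refine Ideal.mul_mem_left _ _ (Ideal.subset_span ⟨?_, fun j => ?_⟩)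
  · rw [add_comm]; exact (isHomogeneous_X k 0).mul hh
  · rw [map_mul, hv j, mul_zero]

theorem colon_step (hp : ∀ j, p j 0 ≠ 0) (heh : ∀ j, (e j).IsHomogeneous s)
    (hee : ∀ i j, eval (p j) (e i) = if i = j then 1 else 0) (r : ℕ) (F : MvPolynomial (Fin 4) k)
    (hF : X 0 * F ∈ maxIdeal k 3 * Ideal.span (vanDeg p (s + 1)) ^ r) :
    F ∈ Ideal.span (vanDeg p (s + 1)) ^ r := by
  refine colon_x (σ := s + 1) (L := Lc p e) _ ?_ ?_ ?_ ?_ r F hF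
  · intro w hw
    exact Ideal.subset_span (Lc_mem hp heh hee w hw)
  · intro w _
    rw [Lc, map_sub, map_mul, piz_X_zero, zero_mul, sub_zero, piz_Yc]
  · intro v i j hv
    have hvi : (v + Finsupp.single i 1).degree = s + 1 := by rw [map_add, Finsupp.degree_single, hv]
    have hvj : (v + Finsupp.single j 1).degree = s + 1 := by rw [map_add, Finsupp.degree_single, hv]
    have hY : Yc k (Finsupp.single j 1) * Yc k (v + Finsupp.single i 1) =
        Yc k (Finsupp.single i 1) * Yc k (v + Finsupp.single j 1) := by
      rw [Yc_add, Yc_add]; ring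
    have heq : Yc k (Finsupp.single j 1) * Lc p e (v + Finsupp.single i 1) -
        Yc k (Finsupp.single i 1) * Lc p e (v + Finsupp.single j 1) =
        X 0 * (Yc k (Finsupp.single i 1) * gcor p e (v + Finsupp.single j 1) -
          Yc k (Finsupp.single j 1) * gcor p e (v + Finsupp.single i 1)) := by
      rw [Lc, Lc]
      linear_combination hY
    rw [heq]
    refine Ideal.mul_mem_mul (Ideal.mem_span_singleton_self _) (Ideal.subset_span ⟨?_, ?_⟩)
    · rw [Yc_single, Yc_single, add_comm s 1]
      exact ((isHomogeneous_X k _).mul (gcor_hom heh _)).sub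
        ((isHomogeneous_X k _).mul (gcor_hom heh _))
    · apply van_of_mul hp
      intro l
      rw [← heq, map_sub, map_mul, map_mul, (Lc_mem hp heh hee _ hvi).2, (Lc_mem hp heh hee _ hvj).2]
      simp
  · rintro f ⟨hfh, hfv⟩
    obtain ⟨P, hP, h, hh, hfe⟩ := decomp_hom (p := p) heh hfh
    refine ⟨P, hP, h, hfe, ?_⟩
    have hv : ∀ j, eval (p j) h = 0 := by
      apply van_of_mul hp
      intro j
      have h1 := hfv j
      rwa [hfe, map_add, eval_of_mem_span_vanDeg (span_Lc_le hp heh hee hP), zero_add] at h1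
    have : Ideal.span {h} * maxIdeal k 3 ≤ Ideal.span (vanDeg p (s + 1)) := by
      rw [maxIdeal, Ideal.span_mul_span', Ideal.span_le]
      rintro _ ⟨_, rfl, _, ⟨i, rfl⟩, rfl⟩
      refine Ideal.subset_span ⟨hh.mul (isHomogeneous_X k i), fun j => ?_⟩
      rw [map_mul, hv j, zero_mul]
    intro m hm
    exact this (Ideal.mul_mem_mul (Ideal.mem_span_singleton_self _) hm)

theorem genDeg_van (d : ℕ) : GenDeg (Ideal.span (vanDeg p d)) d :=
  ⟨_, rfl, fun _ ha => ha.1⟩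

theorem colon_pow (hp : ∀ j, p j 0 ≠ 0) (heh : ∀ j, (e j).IsHomogeneous s)
    (hee : ∀ i j, eval (p j) (e i) = if i = j then 1 else 0) (r t N : ℕ)
    (F : MvPolynomial (Fin 4) k) (hFh : F.IsHomogeneous t) (ht : r * (s + 1) ≤ t)
    (hF : X 0 ^ N * F ∈ Ideal.span (vanDeg p (s + 1)) ^ r) :
    F ∈ Ideal.span (vanDeg p (s + 1)) ^ r := by
  induction N with
  | zero => simpa using hF
  | succ N ih =>
    apply ih
    apply colon_step hp heh hee
    rw [pow_succ', mul_assoc] at hF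
    have hh : (X 0 * (X 0 ^ N * F)).IsHomogeneous (1 + (N + t)) :=
      (isHomogeneous_X k 0).mul ((isHomogeneous_X_pow 0 N).mul hFh)
    have := ((genDeg_van (p := p) (s + 1)).pow r).mem (e := 1) hF hh (by omega)
    rwa [pow_one] at this

/-- Some power of `x₀` moves the symbolic power into the ordinary power. -/
theorem exists_pow_mul_mem (hp : ∀ j, p j 0 ≠ 0) (heh : ∀ j, (e j).IsHomogeneous s)
    (hee : ∀ i j, eval (p j) (e i) = if i = j then 1 else 0) (r : ℕ)
    (F : MvPolynomial (Fin 4) k) (hF : ∀ j, F ∈ pointIdeal (p j) ^ r) :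
    ∃ N, X 0 ^ N * F ∈ Ideal.span (vanDeg p (s + 1)) ^ r := by
  set J := Ideal.span (vanDeg p (s + 1)) with hJ
  let A : Ideal (MvPolynomial (Fin 4) k) := 
    Submodule.comap (LinearMap.toSpanSingleton (MvPolynomial (Fin 4) k) _ F) (J ^ r)
  have hA : ∀ a, a ∈ A ↔ a * F ∈ J ^ r := fun a => Iff.rfl
  have h1 : ∀ j, X 0 * e j ∈ A.radical := by
    intro j
    refine ⟨r, ?_⟩
    rw [hA]
    have h2 : Ideal.span {X 0 * e j} * pointIdeal (p j) ≤ J := by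
      rw [pointIdeal, Ideal.span_mul_span', Ideal.span_le]
      rintro _ ⟨_, rfl, g, ⟨⟨d, hd⟩, hg⟩, rfl⟩
      refine van_high hp heh hee d ?_ ?_
      · rw [add_comm s 1]
        exact ((isHomogeneous_X k 0).mul (heh j)).mul hd
      · intro i
        simp only [map_mul]
        by_cases hij : j = i
        · subst hij; rw [hg, mul_zero]
        · rw [hee, if_neg hij]; ring
    have h3 := Ideal.pow_right_mono h2 r
    rw [mul_pow] at h3
    exact h3 (Ideal.mul_mem_mul (Ideal.pow_mem_pow (Ideal.mem_span_singleton_self _) r) (hF j))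
  have h2 : J ≤ A.radical := by
    intro f hf
    exact ⟨r, (hA _).mpr (Ideal.mul_mem_right _ _ (Ideal.pow_mem_pow hf r))⟩
  have h3 : X 0 ^ (s + 1) - ∑ j, C (p j 0 ^ s) * (X 0 * e j) ∈ J := by
    refine Ideal.subset_span ⟨?_, ?_⟩
    · refine (isHomogeneous_X_pow 0 (s + 1)).sub (IsHomogeneous.sum _ _ _ fun j _ => ?_)
      rw [add_comm]
      exact ((isHomogeneous_X k 0).mul (heh j)).C_mul _
    · intro i
      simp only [map_sub, map_pow, eval_X, map_sum, map_mul, eval_C, hee, mul_ite, mul_one, mul_zero,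
        Finset.sum_ite_eq', Finset.mem_univ, if_true]
      ring
  have h4 : X 0 ^ (s + 1) ∈ A.radical := by
    have h5 : ∑ j, C (p j 0 ^ s) * (X 0 * e j) ∈ A.radical :=
      Ideal.sum_mem _ fun j _ => Ideal.mul_mem_left _ _ (h1 j)
    have := Ideal.add_mem _ (h2 h3) h5
    rwa [sub_add_cancel] at this
  obtain ⟨N, hN⟩ := h4
  rw [← pow_mul, hA] at hN
  exact ⟨_, hN⟩

theorem span_van_le (d : ℕ) : Ideal.span (vanDeg p d) ≤ fatIdeal (N := 3) p (fun _ => 1) := by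
  rw [Ideal.span_le]
  rintro f ⟨hf, hv⟩
  rw [SetLike.mem_coe, fatIdeal, Ideal.mem_iInf]
  intro j
  rw [pow_one]
  exact Ideal.subset_span ⟨⟨d, hf⟩, hv j⟩

theorem containment (hp : ∀ j, p j 0 ≠ 0) (heh : ∀ j, (e j).IsHomogeneous s)
    (hee : ∀ i j, eval (p j) (e i) = if i = j then 1 else 0) (r t : ℕ)
    (F : MvPolynomial (Fin 4) k) (hFh : F.IsHomogeneous t) (ht : r * (s + 3) ≤ t)
    (hF : ∀ j, F ∈ pointIdeal (p j) ^ r) :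
    F ∈ maxIdeal k 3 ^ (2 * r) * (fatIdeal (N := 3) p (fun _ => 1)) ^ r := by
  obtain ⟨N, hN⟩ := exists_pow_mul_mem hp heh hee r F hF
  have h1 := colon_pow hp heh hee r t N F hFh (by nlinarith) hN
  have h2 := ((genDeg_van (p := p) (s + 1)).pow r).mem (e := 2 * r) h1 hFh (by nlinarith)
  exact Ideal.mul_mono_right (Ideal.pow_right_mono (span_van_le _) r) h2

end Containment

/-! ### Assembly -/

theorem eval_Yc {k : Type*} [Field k] (x : Fin 4 → k) (hx : x 0 ≠ 0) (w : Fin 3 →₀ ℕ) :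
    eval x (Yc k w) = x 0 ^ w.degree * ∏ l : Fin 3, (x l.succ / x 0) ^ (w l) := by
  rw [Yc, eval_rename, eval_monomial, one_mul, Finsupp.prod_fintype _ _ (fun i => pow_zero _),
    Finsupp.degree_eq_sum, ← Finset.prod_pow_eq_pow_sum, ← Finset.prod_mul_distrib]
  refine Finset.prod_congr rfl fun l _ => ?_
  rw [← mul_pow, mul_div_cancel₀ _ hx]
  rfl

theorem exists_separators {k : Type*} [Field k] {n : ℕ} (p : Fin n → Fin 4 → k) (s : ℕ)
    (hp : ∀ j, p j 0 ≠ 0) (B : Fin n → expLT 3 (s + 1) → k)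
    (hB : ∀ i j, ∑ γ, B i γ * ∏ l : Fin 3, (p j l.succ / p j 0) ^ (γ.1 l) =
      if i = j then 1 else 0) :
    ∃ e : Fin n → MvPolynomial (Fin 4) k, (∀ j, (e j).IsHomogeneous s) ∧
      ∀ i j, eval (p j) (e i) = if i = j then 1 else 0 := by
  refine ⟨fun i => C ((p i 0 ^ s)⁻¹) * ∑ γ, C (B i γ) * (X 0 ^ (s - γ.1.degree) * Yc k γ.1),
    fun i => ?_, fun i j => ?_⟩
  · refine IsHomogeneous.C_mul (IsHomogeneous.sum _ _ _ fun γ _ => IsHomogeneous.C_mul ?_ _) _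
    have h := mem_expLT.mp γ.2
    have h2 := (isHomogeneous_X_pow (R := k) (0 : Fin 4) (s - γ.1.degree)).mul
      (Yc_isHomogeneous (k := k) γ.1)
    rwa [show s - γ.1.degree + γ.1.degree = s by omega] at h2
  · have h1 : ∑ γ : expLT 3 (s + 1), B i γ * (p j 0 ^ (s - γ.1.degree) * eval (p j) (Yc k γ.1)) =
        p j 0 ^ s * if i = j then 1 else 0 := by
      rw [← hB i j, Finset.mul_sum]
      refine Finset.sum_congr rfl fun γ _ => ?_
      have h := mem_expLT.mp γ.2
      rw [eval_Yc _ (hp j), ← mul_assoc (p j 0 ^ (s - γ.1.degree)), ← pow_add,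
        show s - γ.1.degree + γ.1.degree = s by omega]
      ring
    simp only [map_mul, map_sum, eval_C, map_pow, eval_X]
    rw [h1]
    split_ifs with hij
    · subst hij
      rw [mul_one, inv_mul_cancel₀ (pow_ne_zero _ (hp i))]
    · ring

theorem exists_cube_root (n : ℕ) (hn : 512 ≤ n) : ∃ a, 8 ≤ a ∧ a ^ 3 ≤ n ∧ n < (a + 1) ^ 3 := by
  have h : ∃ b, n < (b + 1) ^ 3 := ⟨n, by nlinarith [sq_nonneg (n + 1), sq_nonneg n]⟩
  classical
  refine ⟨Nat.find h, ?_, ?_, Nat.find_spec h⟩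
  · rw [Nat.le_find_iff]
    intro m hm hlt
    have : (m + 1) ^ 3 ≤ 8 ^ 3 := Nat.pow_le_pow_left (by omega) 3
    omega
  · rcases Nat.eq_zero_or_pos (Nat.find h) with h0 | h0
    · rw [h0]; omega
    · have := Nat.find_min h (m := Nat.find h - 1) (by omega)
      rw [show Nat.find h - 1 + 1 = Nat.find h by omega] at this
      omega

theorem component_mem {k : Type*} [Field k] {n : ℕ} (p : Fin n → Fin 4 → k) (m : ℕ)
    (F : MvPolynomial (Fin 4) k) (hF : F ∈ fatIdeal (N := 3) p (fun _ => m)) (t : ℕ) (j : Fin n) :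
    homogeneousComponent t F ∈ pointIdeal (p j) ^ m := by
  let _ := MvPolynomial.gradedAlgebra (σ := Fin 4) (R := k)
  have h1 : (pointIdeal (p j)).IsHomogeneous (homogeneousSubmodule (Fin 4) k) := by
    apply Ideal.homogeneous_span
    rintro f ⟨⟨d, hd⟩, -⟩
    exact ⟨d, hd⟩
  have h2 : (pointIdeal (p j) ^ m).IsHomogeneous (homogeneousSubmodule (Fin 4) k) := by
    induction m with
    | zero =>
      rw [pow_zero, Ideal.one_eq_top]
      exact Ideal.IsHomogeneous.top _
    | succ m ih =>
      rw [pow_succ]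
      exact (ih (Ideal.mem_iInf.mpr fun i =>
        Ideal.pow_le_pow_right (Nat.le_succ m) (Ideal.mem_iInf.mp hF i))).mul h1
  have h3 : F ∈ pointIdeal (p j) ^ m := (Ideal.mem_iInf.mp hF) j
  have h4 := h2 t h3
  have h5 := decomposition.decompose'_apply F t
  rw [← h5]
  exact h4

/-- For every `n ≥ 512` and points in general position in `ℙ³`, the radical ideal
`I = ⋂ⱼ m_{pⱼ}` satisfies `I^(3r) ⊆ M^(2r) * I^r` for all `r ≥ 1`. -/
theorem statement16 (k : Type*) [Field k] [CharZero k] (n : ℕ) (hn : 512 ≤ n) :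
    Generic k 3 n (fun p =>
      ∀ r : ℕ, 1 ≤ r →
        fatIdeal p (fun _ => 3 * r) ≤
          maxIdeal k 3 ^ (2 * r) * (fatIdeal p (fun _ => 1)) ^ r) := by
  obtain ⟨a, ha8, ha, ha'⟩ := exists_cube_root n hn
  refine generic_of_cond k n a ha ha' _ fun p hp hJ hBex r _ => ?_
  obtain ⟨B, hB⟩ := hBex
  obtain ⟨e, heh, hee⟩ := exists_separators p (2 * a) hp B hB
  intro F hF
  rw [← sum_homogeneousComponent F]
  refine Ideal.sum_mem _ fun t _ => ?_
  by_cases h0 : homogeneousComponent t F = 0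
  · rw [h0]; exact Ideal.zero_mem _
  have hmem := component_mem p (3 * r) F hF t
  have hh := homogeneousComponent_isHomogeneous t F
  have hb := alpha_bound p hp 40 (a * 37) hJ _ t hh h0 (3 * r) hmem
  refine containment hp heh hee r t _ hh ?_ fun j => Ideal.pow_le_pow_right (by omega) (hmem j)
  have h1 : r * 8 ≤ r * a := Nat.mul_le_mul_left r ha8
  have h2 : 3 * r * (a * 37) = 111 * (r * a) := by ring
  have h3 : r * (2 * a + 3) = 2 * (r * a) + 3 * r := by ring
  omega
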